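/- arXiv:math/0511607 — 4 statements merged into one kernel-verified Lean document; each statement's English description precedes it below -/
import Mathlib

section
/- There exists a constant C > 0 such that, for every integer n ≥ 2, every nontrivial monotone symmetric subset A of {0,1}^n, and every p ∈ (0,1), the derivative with respect to p of the polynomial map p ↦ μ_{n,p}(A) satisfies dμ_p(A)/dp ≥ C · (log n / (p(1−p) · log(2/(p(1−p))))) · μ_p(A)(1 − μ_p(A)). -/
open Finset

/-- Weight of a point `x ∈ {0,1}^n` under the product Bernoulli(p) measure:
`p^{∑ xᵢ} (1-p)^{∑ (1-xᵢ)}`. -/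
noncomputable def muW (n : ℕ) (p : ℝ) (x : Fin n → Bool) : ℝ :=
  ∏ i : Fin n, if x i then p else 1 - p

/-- The measure `μ_{n,p}(A)` of a subset `A ⊆ {0,1}^n`. -/
noncomputable def muP (n : ℕ) (p : ℝ) (A : Finset (Fin n → Bool)) : ℝ :=
  ∑ x ∈ A, muW n p x

/-- Expectation `∫ f dμ_{n,p}` of a real function on `{0,1}^n`. -/
noncomputable def muE (n : ℕ) (p : ℝ) (f : (Fin n → Bool) → ℝ) : ℝ :=
  ∑ x : Fin n → Bool, muW n p x * f x

/-- `A` is monotone: `x ∈ A` and `x ≤ y` coordinatewise imply `y ∈ A`. -/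
def MonotoneSet (n : ℕ) (A : Finset (Fin n → Bool)) : Prop :=
  ∀ x ∈ A, ∀ y : Fin n → Bool, (∀ i, x i ≤ y i) → y ∈ A

/-- `A` is symmetric: invariant under a transitive subgroup of permutations of coordinates. -/
def SymmetricSet (n : ℕ) (A : Finset (Fin n → Bool)) : Prop :=
  ∃ G : Subgroup (Equiv.Perm (Fin n)),
    (∀ i j : Fin n, ∃ g ∈ G, g i = j) ∧
    (∀ g ∈ G, ∀ x ∈ A, (fun i => x (g⁻¹ i)) ∈ A)

/-- Discrete gradient `∇_i f`. -/
noncomputable def grad (n : ℕ) (i : Fin n) (f : (Fin n → Bool) → ℝ)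
    (x : Fin n → Bool) : ℝ :=
  f (Function.update x i true) - f (Function.update x i false)

/-- The operator `Δ_i f = f - ∫ f dμ_{1,p}(x_i)`. -/
noncomputable def del (n : ℕ) (p : ℝ) (i : Fin n) (f : (Fin n → Bool) → ℝ)
    (x : Fin n → Bool) : ℝ :=
  f x - (p * f (Function.update x i true) + (1 - p) * f (Function.update x i false))

open Classical in
/-- Influence of coordinate `i` on a function `f`: the `μ_{n,p}`-probability
that `f` is not constant on the `i`-th fiber. -/
noncomputable def infl (n : ℕ) (p : ℝ) (i : Fin n) (f : (Fin n → Bool) → ℝ) : ℝ :=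
  muP n p (Finset.univ.filter fun x =>
    f (Function.update x i true) ≠ f (Function.update x i false))

open Classical in
/-- Influence of coordinate `i` on a set `A`. -/
noncomputable def inflSet (n : ℕ) (p : ℝ) (i : Fin n) (A : Finset (Fin n → Bool)) : ℝ :=
  muP n p (Finset.univ.filter fun x =>
    ¬((Function.update x i true ∈ A) ↔ (Function.update x i false ∈ A)))

/-- Entropy of a (nonnegative) function with respect to `μ_{n,p}`. -/
noncomputable def ent (n : ℕ) (p : ℝ) (g : (Fin n → Bool) → ℝ) : ℝ :=
  muE n p (fun x => g x * Real.log (g x)) - muE n p g * Real.log (muE n p g)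

/-- Variance of a function with respect to `μ_{n,p}`. -/
noncomputable def varE (n : ℕ) (p : ℝ) (f : (Fin n → Bool) → ℝ) : ℝ :=
  muE n p (fun x => f x ^ 2) - (muE n p f) ^ 2

/-- Conditional expectation `E[f | x_1, …, x_j]` under `μ_{n,p}`:
average over the last `n - j` coordinates. -/
noncomputable def condE (n : ℕ) (p : ℝ) (j : ℕ) (f : (Fin n → Bool) → ℝ)
    (x : Fin n → Bool) : ℝ :=
  ∑ y : Fin n → Bool,
    (∏ i : Fin n, if (i : ℕ) < j then (if y i = x i then (1 : ℝ) else 0)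
      else (if y i then p else 1 - p)) * f y

/-- The logarithmic Sobolev constant of the two-point Bernoulli(p) space. -/
noncomputable def cLS (p : ℝ) : ℝ :=
  if p = 1 / 2 then 2 else (Real.log (1 - p) - Real.log p) / (1 - 2 * p)

/-- The sequence `s(n)` of Theorem 4.1. -/
noncomputable def sseq (n : ℕ) : ℝ :=
  Real.log n -
    max (Real.log ((Real.exp 1 ^ (2 + 4 / Real.exp 1) / (2 : ℝ) ^ (5 + 4 / Real.exp 1)) *
        Real.log ((n : ℝ) / Real.log n ^ 2) ^ (3 + 4 / Real.exp 1)))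
      (2 * Real.log (Real.log n))

namespace Sharp

/-- averaging operator over coordinate `i` -/
noncomputable def avg {n : ℕ} (p : ℝ) (i : Fin n) (f : (Fin n → Bool) → ℝ) (x : Fin n → Bool) : ℝ :=
  p * f (Function.update x i true) + (1 - p) * f (Function.update x i false)

/-- weight without coordinate `i` -/
noncomputable def wOff {n : ℕ} (p : ℝ) (i : Fin n) (x : Fin n → Bool) : ℝ :=
  ∏ j ∈ Finset.univ.erase i, if x j then p else 1 - p

lemma muW_eq {n : ℕ} (p : ℝ) (i : Fin n) (x : Fin n → Bool) :
    muW n p x = (if x i then p else 1 - p) * wOff p i x := by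
  unfold muW wOff
  rw [Finset.mul_prod_erase Finset.univ (fun j => if x j then p else 1 - p) (Finset.mem_univ i)]

lemma wOff_update {n : ℕ} (p : ℝ) (i : Fin n) (x : Fin n → Bool) (b : Bool) :
    wOff p i (Function.update x i b) = wOff p i x := by
  unfold wOff
  apply Finset.prod_congr rfl
  intro j hj
  rw [Function.update_of_ne (Finset.ne_of_mem_erase hj)]

lemma sum_flip {n : ℕ} (i : Fin n) (F : (Fin n → Bool) → ℝ) :
    ∑ x, F (Function.update x i (!(x i))) = ∑ x, F x := by
  have h : Function.Involutive (fun x : Fin n → Bool => Function.update x i (!(x i))) := by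
    intro x
    simp
  exact Equiv.sum_comp h.toPerm F

lemma sum_pair {n : ℕ} (i : Fin n) (F : (Fin n → Bool) → ℝ) :
    2 * ∑ x, F x = ∑ x, (F (Function.update x i true) + F (Function.update x i false)) := by
  have h1 : 2 * ∑ x, F x = ∑ x, (F x + F (Function.update x i (!(x i)))) := by
    rw [Finset.sum_add_distrib, sum_flip]; ring
  rw [h1]
  apply Finset.sum_congr rfl
  intro x _
  have hx : Function.update x i (x i) = x := Function.update_eq_self i x
  cases hb : x i
  · rw [hb] at hx; simp [hx]; ring
  · rw [hb] at hx; simp [hx]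

lemma sum_wOff {n : ℕ} (p : ℝ) (i : Fin n) (G : (Fin n → Bool) → ℝ) :
    ∑ x, wOff p i x * G x =
      muE n p (fun x => G (Function.update x i true) + G (Function.update x i false)) := by
  have h1 := sum_pair i (fun x => wOff p i x * G x)
  have h2 := sum_pair i (fun x => muW n p x *
    (G (Function.update x i true) + G (Function.update x i false)))
  have h3 : (2:ℝ) * ∑ x, wOff p i x * G x = 2 * muE n p
      (fun x => G (Function.update x i true) + G (Function.update x i false)) := by
    unfold muE
    rw [h1, h2]
    apply Finset.sum_congr rfl
    intro x _
    simp only [muW_eq p i, wOff_update, Function.update_idem, Function.update_self]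
    simp
    ring
  linarith

lemma muE_avg {n : ℕ} (p : ℝ) (i : Fin n) (f : (Fin n → Bool) → ℝ) :
    muE n p (avg p i f) = muE n p f := by
  have h := sum_wOff p i (fun x => (if x i then p else 1 - p) * f x)
  have e1 : ∑ x, wOff p i x * ((if x i then p else 1 - p) * f x) = muE n p f := by
    unfold muE
    apply Finset.sum_congr rfl
    intro x _
    rw [muW_eq p i]; ring
  rw [e1] at h
  rw [h]
  congr 1
  funext x
  simp [avg]

lemma muW_nonneg {n : ℕ} {p : ℝ} (h0 : 0 < p) (h1 : p < 1) (x : Fin n → Bool) : 0 ≤ muW n p x := by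
  unfold muW
  apply Finset.prod_nonneg
  intro i _
  split_ifs <;> linarith

lemma muE_mono {n : ℕ} {p : ℝ} (h0 : 0 < p) (h1 : p < 1) {f g : (Fin n → Bool) → ℝ}
    (h : ∀ x, f x ≤ g x) : muE n p f ≤ muE n p g := by
  unfold muE
  apply Finset.sum_le_sum
  intro x _
  exact mul_le_mul_of_nonneg_left (h x) (muW_nonneg h0 h1 x)

lemma muE_nonneg {n : ℕ} {p : ℝ} (h0 : 0 < p) (h1 : p < 1) {f : (Fin n → Bool) → ℝ}
    (h : ∀ x, 0 ≤ f x) : 0 ≤ muE n p f := by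
  unfold muE
  exact Finset.sum_nonneg fun x _ => mul_nonneg (muW_nonneg h0 h1 x) (h x)

lemma muE_add {n : ℕ} (p : ℝ) (f g : (Fin n → Bool) → ℝ) :
    muE n p (fun x => f x + g x) = muE n p f + muE n p g := by
  unfold muE; rw [← Finset.sum_add_distrib]; apply Finset.sum_congr rfl; intros; ring

lemma muE_sub {n : ℕ} (p : ℝ) (f g : (Fin n → Bool) → ℝ) :
    muE n p (fun x => f x - g x) = muE n p f - muE n p g := by
  unfold muE; rw [← Finset.sum_sub_distrib]; apply Finset.sum_congr rfl; intros; ring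

lemma muE_smul {n : ℕ} (p c : ℝ) (f : (Fin n → Bool) → ℝ) :
    muE n p (fun x => c * f x) = c * muE n p f := by
  unfold muE; rw [Finset.mul_sum]; apply Finset.sum_congr rfl; intros; ring

lemma muE_const {n : ℕ} (p c : ℝ) : muE n p (fun _ => c) = c := by
  unfold muE
  rw [← Finset.sum_mul]
  have h : ∑ x : Fin n → Bool, muW n p x = 1 := by
    unfold muW
    have := Finset.prod_univ_sum (fun _ : Fin n => (Finset.univ : Finset Bool))
      (fun _ b => if b then p else 1 - p)
    simp at this
    exact this.symm
  rw [h, one_mul]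

lemma muE_sum {n : ℕ} {ι : Type*} (p : ℝ) (s : Finset ι) (F : ι → (Fin n → Bool) → ℝ) :
    muE n p (fun x => ∑ k ∈ s, F k x) = ∑ k ∈ s, muE n p (F k) := by
  unfold muE
  rw [Finset.sum_comm]
  apply Finset.sum_congr rfl; intros; rw [Finset.mul_sum]

/-- iterated average -/
noncomputable def avgL {n : ℕ} (p : ℝ) (l : List (Fin n)) (f : (Fin n → Bool) → ℝ) :
    (Fin n → Bool) → ℝ := l.foldr (avg p) f

@[simp] lemma avgL_nil {n : ℕ} (p : ℝ) (f : (Fin n → Bool) → ℝ) : avgL p [] f = f := rfl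

@[simp] lemma avgL_cons {n : ℕ} (p : ℝ) (i : Fin n) (l : List (Fin n)) (f : (Fin n → Bool) → ℝ) :
    avgL p (i :: l) f = avg p i (avgL p l f) := rfl

lemma muE_avgL {n : ℕ} (p : ℝ) (l : List (Fin n)) (f : (Fin n → Bool) → ℝ) :
    muE n p (avgL p l f) = muE n p f := by
  induction l with
  | nil => rfl
  | cons i l ih => rw [avgL_cons, muE_avg, ih]

lemma avg_comm {n : ℕ} (p : ℝ) (i j : Fin n) (f : (Fin n → Bool) → ℝ) :
    avg p i (avg p j f) = avg p j (avg p i f) := by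
  by_cases h : i = j
  · rw [h]
  · funext x
    simp only [avg]
    simp only [Function.update_comm h]
    ring

lemma avg_avgL {n : ℕ} (p : ℝ) (i : Fin n) (l : List (Fin n)) (f : (Fin n → Bool) → ℝ) :
    avg p i (avgL p l f) = avgL p l (avg p i f) := by
  induction l with
  | nil => rfl
  | cons j l ih => rw [avgL_cons, avgL_cons, avg_comm, ih]

lemma avg_idem {n : ℕ} (p : ℝ) (i : Fin n) (f : (Fin n → Bool) → ℝ) :
    avg p i (avg p i f) = avg p i f := by
  funext x; simp [avg]; ring

lemma avg_sub {n : ℕ} (p : ℝ) (i : Fin n) (f g : (Fin n → Bool) → ℝ) :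
    avg p i (fun x => f x - g x) = fun x => avg p i f x - avg p i g x := by
  funext x; simp [avg]; ring

lemma avgL_sub {n : ℕ} (p : ℝ) (l : List (Fin n)) (f g : (Fin n → Bool) → ℝ) :
    avgL p l (fun x => f x - g x) = fun x => avgL p l f x - avgL p l g x := by
  induction l with
  | nil => rfl
  | cons j l ih => rw [avgL_cons, ih, avg_sub]; rfl

lemma del_eq {n : ℕ} (p : ℝ) (i : Fin n) (f : (Fin n → Bool) → ℝ) :
    del n p i f = fun x => f x - avg p i f x := rfl

lemma del_avgL {n : ℕ} (p : ℝ) (i : Fin n) (l : List (Fin n)) (f : (Fin n → Bool) → ℝ) :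
    del n p i (avgL p l f) = avgL p l (del n p i f) := by
  rw [del_eq, del_eq, avgL_sub, avg_avgL]

lemma del_comm {n : ℕ} (p : ℝ) (i k : Fin n) (f : (Fin n → Bool) → ℝ) :
    del n p i (del n p k f) = del n p k (del n p i f) := by
  funext x
  simp only [del_eq, avg_sub, avg_comm p i k]
  ring

/-- the average over all coordinates is the expectation -/
lemma avgL_all {n : ℕ} (p : ℝ) (l : List (Fin n)) (hl : ∀ i, i ∈ l) (f : (Fin n → Bool) → ℝ) :
    avgL p l f = fun _ => muE n p f := by
  have hinv : ∀ i (x : Fin n → Bool) b,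
      avgL p l f (Function.update x i b) = avgL p l f x := by
    have key : ∀ l : List (Fin n), ∀ i ∈ l, avg p i (avgL p l f) = avgL p l f := by
      intro l
      induction l with
      | nil => simp
      | cons j l ih =>
        intro i hi
        rcases List.mem_cons.1 hi with rfl | hi
        · rw [avgL_cons, avg_idem]
        · rw [avgL_cons, avg_comm, ih i hi]
    intro i x b
    rw [← key l i (hl i)]
    simp [avg]
  have hconst : ∀ x y, avgL p l f x = avgL p l f y := by
    intro x y
    have : ∀ s : Finset (Fin n), avgL p l f (fun i => if i ∈ s then y i else x i) = avgL p l f x := by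
      intro s
      induction s using Finset.induction with
      | empty => simp
      | insert a s ha ih =>
        rw [← ih, ← hinv a (fun i => if i ∈ s then y i else x i) (y a)]
        congr 1
        funext i
        by_cases h : i = a
        · subst h; simp
        · simp [h]
    have := this Finset.univ
    simp at this
    exact this.symm
  funext x
  have h2 : muE n p (avgL p l f) = avgL p l f x := by
    have : avgL p l f = fun _ => avgL p l f x := by funext y; exact hconst y x
    rw [this, muE_const]
  rw [← h2, muE_avgL]

/-- Pythagoras -/
lemma pyth {n : ℕ} (p : ℝ) (i : Fin n) (f : (Fin n → Bool) → ℝ) :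
    muE n p (fun x => del n p i f x ^ 2) =
      muE n p (fun x => f x ^ 2) - muE n p (fun x => avg p i f x ^ 2) := by
  rw [← muE_sub, ← muE_avg p i (fun x => del n p i f x ^ 2),
    ← muE_avg p i (fun x => f x ^ 2 - _)]
  congr 1
  funext x
  simp [avg, del]
  ring

lemma del_sq {n : ℕ} (p : ℝ) (i : Fin n) (f : (Fin n → Bool) → ℝ) :
    muE n p (fun x => del n p i f x ^ 2) = p * (1 - p) * muE n p (fun x => grad n i f x ^ 2) := by
  rw [← muE_avg p i, ← muE_smul]
  congr 1
  funext x
  simp [avg, del, grad]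
  ring

lemma del_abs {n : ℕ} {p : ℝ} (h0 : 0 < p) (h1 : p < 1) (i : Fin n) (f : (Fin n → Bool) → ℝ) :
    muE n p (fun x => |del n p i f x|) = 2 * (p * (1 - p)) * muE n p (fun x => |grad n i f x|) := by
  rw [← muE_avg p i, ← muE_smul]
  congr 1
  funext x
  simp only [avg, del, grad, Function.update_idem]
  generalize f (Function.update x i true) = a
  generalize f (Function.update x i false) = b
  have e1 : a - (p * a + (1 - p) * b) = (1 - p) * (a - b) := by ring
  have e2 : b - (p * a + (1 - p) * b) = - (p * (a - b)) := by ring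
  rw [e1, e2, abs_neg, abs_mul, abs_mul, abs_of_pos h0, abs_of_pos (by linarith : 0 < 1 - p)]
  ring

lemma abs_avgL {n : ℕ} {p : ℝ} (h0 : 0 < p) (h1 : p < 1) (l : List (Fin n))
    (f : (Fin n → Bool) → ℝ) (x) : |avgL p l f x| ≤ avgL p l (fun x => |f x|) x := by
  induction l generalizing x with
  | nil => simp
  | cons i l ih =>
    simp only [avgL_cons, avg]
    refine (abs_add_le _ _).trans ?_
    rw [abs_mul, abs_mul, abs_of_pos h0, abs_of_pos (by linarith : 0 < 1 - p)]
    have := ih (Function.update x i true)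
    have := ih (Function.update x i false)
    have : 0 < 1 - p := by linarith
    gcongr

/-- Russo's formula -/
lemma russo {n : ℕ} (p : ℝ) (A : Finset (Fin n → Bool)) :
    deriv (fun q => muP n q A) p =
      ∑ i, muE n p (grad n i (fun x => if x ∈ A then 1 else 0)) := by
  have hW : ∀ x : Fin n → Bool, HasDerivAt (fun q => muW n q x)
      (∑ i, wOff p i x * (if x i then 1 else -1)) p := by
    intro x
    have := HasDerivAt.fun_finsetProd (u := (Finset.univ : Finset (Fin n)))
      (f := fun i q => if x i then q else 1 - q) (f' := fun i => if x i then (1:ℝ) else -1) (x := p)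
      (by
        intro i _
        by_cases h : x i
        · simp only [h, if_true]; exact hasDerivAt_id p
        · simp only [h]; simpa using (hasDerivAt_id p).const_sub 1)
    simpa [muW, wOff] using this
  have hP : HasDerivAt (fun q => muP n q A)
      (∑ x ∈ A, ∑ i, wOff p i x * (if x i then 1 else -1)) p := by
    unfold muP
    exact HasDerivAt.fun_sum fun x _ => hW x
  rw [hP.deriv, Finset.sum_comm]
  apply Finset.sum_congr rfl
  intro i _
  have h := sum_wOff p i (fun x => (if x i then 1 else -1) * (if x ∈ A then 1 else 0))
  have e : muE n p (grad n i (fun x => if x ∈ A then (1:ℝ) else 0)) =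
      muE n p (fun x => (fun x => (if x i then (1:ℝ) else -1) * (if x ∈ A then 1 else 0)) (Function.update x i true) + (fun x => (if x i then (1:ℝ) else -1) * (if x ∈ A then 1 else 0)) (Function.update x i false)) := by
    congr 1
    funext x
    simp only [grad, Function.update_self, if_true, one_mul, Bool.false_eq_true, if_false]
    ring
  rw [e, ← h, ← Finset.sum_subset (Finset.subset_univ A)]
  · apply Finset.sum_congr rfl
    intro x hx
    simp [hx]
  · intro x _ hx
    simp [hx]

lemma grad_symm {n : ℕ} (p : ℝ) (A : Finset (Fin n → Bool)) (hA : SymmetricSet n A) (i j : Fin n) :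
    muE n p (grad n i (fun x => if x ∈ A then 1 else 0)) =
      muE n p (grad n j (fun x => if x ∈ A then 1 else 0)) := by
  obtain ⟨G, hG, hinv⟩ := hA
  obtain ⟨g, hg, hgij⟩ := hG i j
  have hmem : ∀ x : Fin n → Bool, (fun k => x (g⁻¹ k)) ∈ A ↔ x ∈ A := by
    intro x
    refine ⟨fun h => ?_, fun h => hinv g hg x h⟩
    have := hinv g⁻¹ (G.inv_mem hg) _ h
    simpa using this
  symm
  unfold muE
  rw [← Equiv.sum_comp (Equiv.arrowCongr g (Equiv.refl Bool))]
  apply Finset.sum_congr rfl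
  intro x _
  have ex : (Equiv.arrowCongr g (Equiv.refl Bool)) x = fun k => x (g⁻¹ k) := by
    funext k; rfl
  have hup : ∀ b, Function.update (fun k => x (g⁻¹ k)) j b =
      fun k => Function.update x i b (g⁻¹ k) := by
    intro b
    funext k
    by_cases h : k = j
    · subst h; simp [← hgij]
    · have : g⁻¹ k ≠ i := by
        intro h'; apply h; rw [← hgij, ← h']; simp
      rw [Function.update_of_ne h, Function.update_of_ne this]
  rw [ex]
  congr 1
  · unfold muW
    rw [← Equiv.prod_comp g]
    simp
  · simp only [grad, hup, hmem]

/-- two point entropy bound -/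
lemma two_point_aux {p a b : ℝ} (h0 : 0 < p) (h1 : p ≤ 1 / 2) (ha : 0 ≤ a) (hb : 0 ≤ b) :
    p * (a ^ 2 * Real.log (a ^ 2)) + (1 - p) * (b ^ 2 * Real.log (b ^ 2)) -
      (p * a ^ 2 + (1 - p) * b ^ 2) * Real.log (p * a ^ 2 + (1 - p) * b ^ 2) ≤
      16 * Real.log (2 / (p * (1 - p))) * (p * (1 - p)) * (a - b) ^ 2 := by
  have hq : 0 < 1 - p := by linarith
  have hv : 0 < p * (1 - p) := by positivity
  have hv4 : p * (1 - p) ≤ 1 / 4 := by nlinarith [sq_nonneg (p - 1 / 2)]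
  have hL : 2 ≤ Real.log (2 / (p * (1 - p))) := by
    have h8 : (8:ℝ) ≤ 2 / (p * (1 - p)) := by
      rw [le_div_iff₀ hv]; linarith
    have : Real.log 8 ≤ Real.log (2 / (p * (1 - p))) := Real.log_le_log (by norm_num) h8
    have e : Real.log 8 = 3 * Real.log 2 := by
      rw [show (8:ℝ) = 2 ^ 3 by norm_num, Real.log_pow]; norm_num
    have := Real.log_two_gt_d9
    linarith
  have hLp : -Real.log p ≤ Real.log (2 / (p * (1 - p))) := by
    rw [← Real.log_inv]
    apply Real.log_le_log (by positivity)
    rw [le_div_iff₀ hv]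
    have : p⁻¹ * (p * (1 - p)) = 1 - p := by field_simp
    rw [this]; linarith
  set L := Real.log (2 / (p * (1 - p))) with hLdef
  set m := p * a ^ 2 + (1 - p) * b ^ 2 with hm
  have hm0 : 0 ≤ m := by positivity
  rcases hm0.eq_or_lt with hmz | hmpos
  · have hz1 : p * a ^ 2 = 0 := by
      have : 0 ≤ p * a ^ 2 := by positivity
      have : 0 ≤ (1 - p) * b ^ 2 := by positivity
      linarith
    have hz2 : (1 - p) * b ^ 2 = 0 := by
      have : 0 ≤ p * a ^ 2 := by positivity
      have : 0 ≤ (1 - p) * b ^ 2 := by positivity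
      linarith
    have ha2 : a = 0 := by simpa [h0.ne'] using hz1
    have hb2 : b = 0 := by simpa [hq.ne'] using hz2
    rw [← hmz]
    simp [ha2, hb2]
  have key : ∀ t : ℝ, 0 ≤ t → t ^ 2 * Real.log (t ^ 2) ≤ t ^ 2 * Real.log m + t ^ 2 * (t ^ 2 / m - 1) := by
    intro t ht
    rcases ht.eq_or_lt with rfl | htp
    · simp
    · have := Real.log_le_sub_one_of_pos (show 0 < t ^ 2 / m by positivity)
      rw [Real.log_div (by positivity) hmpos.ne'] at this
      have h2 : 0 ≤ t ^ 2 := by positivity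
      nlinarith
  by_cases hab : a ≤ 3 * b
  · have k1 := mul_le_mul_of_nonneg_left (key a ha) h0.le
    have k2 := mul_le_mul_of_nonneg_left (key b hb) hq.le
    have e : p * (a ^ 2 * Real.log m + a ^ 2 * (a ^ 2 / m - 1)) +
        (1 - p) * (b ^ 2 * Real.log m + b ^ 2 * (b ^ 2 / m - 1)) - m * Real.log m =
        p * (1 - p) * (a - b) ^ 2 * ((a + b) ^ 2 / m) := by
      field_simp
      rw [hm]
      ring
    have hr : (a + b) ^ 2 / m ≤ 32 := by
      rw [div_le_iff₀ hmpos, hm]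
      have : a ^ 2 * p ≥ 0 := by positivity
      nlinarith [mul_nonneg hb hb]
    have hr2 : (a + b) ^ 2 / m ≤ 16 * L := by linarith
    have : p * (1 - p) * (a - b) ^ 2 * ((a + b) ^ 2 / m) ≤ p * (1 - p) * (a - b) ^ 2 * (16 * L) :=
      mul_le_mul_of_nonneg_left hr2 (by positivity)
    linarith
  · push Not at hab
    have hapos : 0 < a := by linarith
    have hbm : b ^ 2 ≤ m := by
      rw [hm]
      have : b ^ 2 ≤ a ^ 2 := by apply pow_le_pow_left₀ hb; linarith
      nlinarith
    have k2 : b ^ 2 * Real.log (b ^ 2) ≤ b ^ 2 * Real.log m := by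
      rcases hb.eq_or_lt with rfl | hbp
      · simp
      · exact mul_le_mul_of_nonneg_left (Real.log_le_log (by positivity) hbm) (by positivity)
    have k1 : a ^ 2 * Real.log (a ^ 2) ≤ a ^ 2 * (Real.log m + L) := by
      apply mul_le_mul_of_nonneg_left _ (by positivity)
      have : Real.log (p * a ^ 2) ≤ Real.log m := by
        apply Real.log_le_log (by positivity)
        have : 0 ≤ (1 - p) * b ^ 2 := by positivity
        linarith
      rw [Real.log_mul h0.ne' (by positivity)] at this
      linarith
    have k1' := mul_le_mul_of_nonneg_left k1 h0.le
    have k2' := mul_le_mul_of_nonneg_left k2 hq.le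
    have e : p * (a ^ 2 * (Real.log m + L)) + (1 - p) * (b ^ 2 * Real.log m) - m * Real.log m =
        p * L * a ^ 2 := by rw [hm]; ring
    have h3 : a ^ 2 ≤ 16 * (1 - p) * (a - b) ^ 2 := by
      have : (a - b) ^ 2 ≥ (2 / 3 * a) ^ 2 := by
        apply pow_le_pow_left₀ (by positivity); linarith
      nlinarith [sq_nonneg (a-b)]
    have : p * L * a ^ 2 ≤ p * L * (16 * (1 - p) * (a - b) ^ 2) :=
      mul_le_mul_of_nonneg_left h3 (by positivity)
    linarith

lemma two_point {p a b : ℝ} (h0 : 0 < p) (h1 : p < 1) (ha : 0 ≤ a) (hb : 0 ≤ b) :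
    p * (a ^ 2 * Real.log (a ^ 2)) + (1 - p) * (b ^ 2 * Real.log (b ^ 2)) -
      (p * a ^ 2 + (1 - p) * b ^ 2) * Real.log (p * a ^ 2 + (1 - p) * b ^ 2) ≤
      16 * Real.log (2 / (p * (1 - p))) * (p * (1 - p)) * (a - b) ^ 2 := by
  rcases le_total p (1 / 2) with h | h
  · exact two_point_aux h0 h ha hb
  · have := two_point_aux (p := 1 - p) (a := b) (b := a) (by linarith) (by linarith) hb ha
    have e : 1 - (1 - p) = p := by ring
    rw [e] at this
    rw [mul_comm p (1 - p), show (a - b) ^ 2 = (b - a) ^ 2 by ring,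
      add_comm (p * a ^ 2), add_comm (p * (a ^ 2 * _))]
    exact this

lemma two_point_sqrt {p u w : ℝ} (h0 : 0 < p) (h1 : p < 1) (ha : 0 ≤ u) (hb : 0 ≤ w) :
    p * (u * Real.log u) + (1 - p) * (w * Real.log w) -
      (p * u + (1 - p) * w) * Real.log (p * u + (1 - p) * w) ≤
      16 * Real.log (2 / (p * (1 - p))) * (p * (1 - p)) * (√u - √w) ^ 2 := by
  have := two_point h0 h1 (Real.sqrt_nonneg u) (Real.sqrt_nonneg w)
  rwa [Real.sq_sqrt ha, Real.sq_sqrt hb] at this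

lemma mink2 {p a1 a0 b1 b0 : ℝ} (h0 : 0 < p) (h1 : p < 1) (ha1 : 0 ≤ a1) (ha0 : 0 ≤ a0)
    (hb1 : 0 ≤ b1) (hb0 : 0 ≤ b0) :
    (√(p * a1 + (1 - p) * a0) - √(p * b1 + (1 - p) * b0)) ^ 2 ≤
      p * (√a1 - √b1) ^ 2 + (1 - p) * (√a0 - √b0) ^ 2 := by
  have hq : 0 < 1 - p := by linarith
  have hA : 0 ≤ p * a1 + (1 - p) * a0 := by positivity
  have hB : 0 ≤ p * b1 + (1 - p) * b0 := by positivity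
  have key : p * (√a1 * √b1) + (1 - p) * (√a0 * √b0) ≤
      √(p * a1 + (1 - p) * a0) * √(p * b1 + (1 - p) * b0) := by
    rw [← Real.sqrt_mul hA]
    apply Real.le_sqrt_of_sq_le
    have e1 := Real.sq_sqrt ha1
    have e2 := Real.sq_sqrt ha0
    have e3 := Real.sq_sqrt hb1
    have e4 := Real.sq_sqrt hb0
    rw [← e1, ← e2, ← e3, ← e4]
    simp only [Real.sqrt_sq (Real.sqrt_nonneg _)]
    have : 0 ≤ p * (1 - p) * (√a1 * √b0 - √a0 * √b1) ^ 2 := by positivity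
    nlinarith
  have e1 := Real.sq_sqrt ha1
  have e2 := Real.sq_sqrt ha0
  have e3 := Real.sq_sqrt hb1
  have e4 := Real.sq_sqrt hb0
  have e5 := Real.sq_sqrt hA
  have e6 := Real.sq_sqrt hB
  simp only [sub_sq]
  rw [e1, e2, e3, e4, e5, e6]
  linarith

lemma avgL_nonneg {n : ℕ} {p : ℝ} (h0 : 0 < p) (h1 : p < 1) (l : List (Fin n))
    (f : (Fin n → Bool) → ℝ) (hf : ∀ x, 0 ≤ f x) (x) : 0 ≤ avgL p l f x := by
  have hq : 0 < 1 - p := by linarith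
  induction l generalizing x with
  | nil => exact hf x
  | cons i l ih =>
    simp only [avgL_cons, avg]
    have := ih (Function.update x i true)
    have := ih (Function.update x i false)
    positivity

lemma mink {n : ℕ} {p : ℝ} (h0 : 0 < p) (h1 : p < 1) (l : List (Fin n))
    (a b : (Fin n → Bool) → ℝ) (x) :
    (√(avgL p l (fun y => a y ^ 2) x) - √(avgL p l (fun y => b y ^ 2) x)) ^ 2 ≤
      avgL p l (fun y => (a y - b y) ^ 2) x := by
  have hq : 0 < 1 - p := by linarith
  induction l generalizing x with
  | nil =>
    simp only [avgL_nil, Real.sqrt_sq_eq_abs]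
    rw [sub_sq, sub_sq, sq_abs, sq_abs]
    have := le_abs_self (a x * b x)
    rw [abs_mul] at this
    linarith
  | cons i l ih =>
    simp only [avgL_cons, avg]
    have hn := fun (c : (Fin n → Bool) → ℝ) => avgL_nonneg h0 h1 l (fun y => c y ^ 2) (fun y => sq_nonneg _)
    refine (mink2 h0 h1 (hn a _) (hn a _) (hn b _) (hn b _)).trans ?_
    gcongr <;> apply ih

lemma avgL_update {n : ℕ} (p : ℝ) (l : List (Fin n)) (i : Fin n) (hi : i ∉ l) (b : Bool)
    (f : (Fin n → Bool) → ℝ) (x) :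
    avgL p l f (Function.update x i b) = avgL p l (fun y => f (Function.update y i b)) x := by
  induction l generalizing x with
  | nil => rfl
  | cons j l ih =>
    have hij : i ≠ j := fun h => hi (by simp [h])
    have hil : i ∉ l := fun h => hi (by simp [h])
    simp only [avgL_cons, avg]
    rw [← ih hil, ← ih hil, Function.update_comm hij, Function.update_comm hij]

/-- log-Sobolev inequality, list form -/
lemma lsi_list {n : ℕ} {p : ℝ} (h0 : 0 < p) (h1 : p < 1) (l : List (Fin n)) (hl : l.Nodup)
    (g : (Fin n → Bool) → ℝ) :
    muE n p (fun x => g x ^ 2 * Real.log (g x ^ 2)) -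
      muE n p (fun x => avgL p l (fun y => g y ^ 2) x * Real.log (avgL p l (fun y => g y ^ 2) x)) ≤
      16 * Real.log (2 / (p * (1 - p))) *
        (l.map (fun k => muE n p (fun x => del n p k g x ^ 2))).sum := by
  induction l with
  | nil => simp
  | cons i l ih =>
    have ih := ih (List.nodup_cons.1 hl).2
    have hi := (List.nodup_cons.1 hl).1
    set h := avgL p l (fun y => g y ^ 2) with hh
    have hn : ∀ x, 0 ≤ h x := avgL_nonneg h0 h1 l _ (fun y => sq_nonneg _)
    have hv : 0 < p * (1 - p) := mul_pos h0 (by linarith)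
    have hL : 0 ≤ Real.log (2 / (p * (1 - p))) := by
      apply Real.log_nonneg
      rw [le_div_iff₀ hv]; nlinarith [sq_nonneg (p - 1 / 2)]
    have step : muE n p (fun x => h x * Real.log (h x)) -
        muE n p (fun x => avg p i h x * Real.log (avg p i h x)) ≤
        16 * Real.log (2 / (p * (1 - p))) * muE n p (fun x => del n p i g x ^ 2) := by
      rw [← muE_avg p i (fun x => h x * Real.log (h x)), ← muE_sub, del_sq,
        ← muE_avgL p l (fun x => grad n i g x ^ 2), ← muE_smul, ← muE_smul]
      apply muE_mono h0 h1
      intro x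
      have t := two_point_sqrt h0 h1 (hn (Function.update x i true)) (hn (Function.update x i false))
      have mk := mink h0 h1 l (fun y => g (Function.update y i true))
        (fun y => g (Function.update y i false)) x
      rw [hh, avgL_update p l i hi, avgL_update p l i hi] at t
      have t2 := mul_le_mul_of_nonneg_left mk
        (show 0 ≤ 16 * Real.log (2 / (p * (1 - p))) * (p * (1 - p)) by positivity)
      have t3 := t.trans t2
      simp only [avg]
      rw [hh, avgL_update p l i hi, avgL_update p l i hi]
      simp only [grad]
      linarith
    simp only [avgL_cons, List.map_cons, List.sum_cons]
    rw [← hh]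
    linarith

lemma lsi {n : ℕ} {p : ℝ} (h0 : 0 < p) (h1 : p < 1) (g : (Fin n → Bool) → ℝ) :
    muE n p (fun x => g x ^ 2 * Real.log (g x ^ 2)) -
      muE n p (fun x => g x ^ 2) * Real.log (muE n p (fun x => g x ^ 2)) ≤
      16 * Real.log (2 / (p * (1 - p))) * ∑ k, muE n p (fun x => del n p k g x ^ 2) := by
  have := lsi_list h0 h1 (List.finRange n) (List.nodup_finRange n) g
  rw [avgL_all p _ (fun i => List.mem_finRange i), muE_const] at this
  rwa [← List.ofFn_eq_map, List.sum_ofFn] at this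

/-- entropy lower bound -/
lemma ent_lower {n : ℕ} {p : ℝ} (h0 : 0 < p) (h1 : p < 1) (g : (Fin n → Bool) → ℝ)
    (s β : ℝ) (hs : 0 < s) (hβ : muE n p (fun x => |g x|) ≤ β) :
    muE n p (fun x => g x ^ 2) * (Real.log s + 1) - s * β ^ 2 ≤
    muE n p (fun x => g x ^ 2 * Real.log (g x ^ 2)) -
      muE n p (fun x => g x ^ 2) * Real.log (muE n p (fun x => g x ^ 2)) := by
  set a := muE n p (fun x => g x ^ 2) with ha
  set b := muE n p (fun x => |g x|) with hb
  have ha0 : 0 ≤ a := muE_nonneg h0 h1 fun x => sq_nonneg _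
  have hb0 : 0 ≤ b := muE_nonneg h0 h1 fun x => abs_nonneg _
  have hsb : s * b ^ 2 ≤ s * β ^ 2 := by gcongr
  -- for all τ
  have key : ∀ τ : ℝ, 0 < τ → 2 * a * Real.log τ + 2 * a - 2 * τ * b ≤
      muE n p (fun x => g x ^ 2 * Real.log (g x ^ 2)) := by
    intro τ hτ
    have e : 2 * a * Real.log τ + 2 * a - 2 * τ * b =
        muE n p (fun x => (2 * Real.log τ + 2) * g x ^ 2 - 2 * τ * |g x|) := by
      rw [muE_sub, muE_smul, muE_smul]; ring
    rw [e]
    apply muE_mono h0 h1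
    intro x
    rcases eq_or_ne (g x) 0 with hz | hz
    · simp [hz]
    · have hp : 0 < |g x| := abs_pos.2 hz
      have := Real.log_le_sub_one_of_pos (show 0 < τ / |g x| by positivity)
      rw [Real.log_div hτ.ne' hp.ne'] at this
      have h2 := mul_le_mul_of_nonneg_left this (show 0 ≤ |g x| ^ 2 by positivity)
      have e2 : |g x| ^ 2 * (τ / |g x| - 1) = τ * |g x| - |g x| ^ 2 := by field_simp
      rw [e2] at h2
      rw [← sq_abs (g x), Real.log_pow]
      push_cast
      linarith
  rcases ha0.eq_or_lt with haz | hap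
  · -- a = 0
    have hpt : ∀ x, muW n p x * (g x ^ 2) = 0 := by
      intro x
      have := (Finset.sum_eq_zero_iff_of_nonneg (s := Finset.univ)
        (f := fun x => muW n p x * (g x ^ 2))
        (fun x _ => mul_nonneg (muW_nonneg h0 h1 x) (sq_nonneg _))).1 (by
          rw [haz, ha]; rfl)
      exact this x (Finset.mem_univ x)
    have hz : muE n p (fun x => g x ^ 2 * Real.log (g x ^ 2)) = 0 := by
      unfold muE
      apply Finset.sum_eq_zero
      intro x _
      rw [← mul_assoc, hpt x, zero_mul]
    rw [hz, ← haz]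
    have : 0 ≤ s * β ^ 2 := by positivity
    linarith
  · have hbp : 0 < b := by
      rcases hb0.eq_or_lt with hbz | hbp
      · exfalso
        -- a log τ unbounded
        set Q := muE n p (fun x => g x ^ 2 * Real.log (g x ^ 2)) with hQ
        have := key (Real.exp (|Q| / a)) (Real.exp_pos _)
        rw [← hbz, Real.log_exp] at this
        have e : 2 * a * (|Q| / a) = 2 * |Q| := by field_simp
        rw [e] at this
        have := le_abs_self Q
        have := abs_nonneg Q
        linarith
      · exact hbp
    have k := key (a / b) (by positivity)
    have e : 2 * (a / b) * b = 2 * a := by field_simp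
    rw [e, Real.log_div hap.ne' hbp.ne'] at k
    have l1 := Real.log_le_sub_one_of_pos (show 0 < s * b ^ 2 / a by positivity)
    rw [Real.log_div (by positivity) hap.ne', Real.log_mul hs.ne' (by positivity), Real.log_pow] at l1
    push_cast at l1
    have l2 := mul_le_mul_of_nonneg_left l1 hap.le
    have e3 : a * (s * b ^ 2 / a - 1) = s * b ^ 2 - a := by field_simp
    rw [e3] at l2
    linarith

/-- The martingale sum -/
lemma main_list {n : ℕ} {p : ℝ} (h0 : 0 < p) (h1 : p < 1) (f : (Fin n → Bool) → ℝ)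
    (s β : ℝ) (hs : 0 < s) (hβ : ∀ i, muE n p (fun x => |del n p i f x|) ≤ β) (l : List (Fin n)) :
    (muE n p (fun x => f x ^ 2) - muE n p (fun x => avgL p l f x ^ 2)) * (Real.log s + 1)
      - l.length * (s * β ^ 2) ≤
    16 * Real.log (2 / (p * (1 - p))) * ∑ k, (muE n p (fun x => del n p k f x ^ 2) -
      muE n p (fun x => avgL p l (del n p k f) x ^ 2)) := by
  induction l with
  | nil => simp
  | cons i l ih =>
    have hd := del_avgL p i l f
    have hb : muE n p (fun x => |del n p i (avgL p l f) x|) ≤ β := by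
      rw [hd]
      refine (muE_mono h0 h1 (abs_avgL h0 h1 l _)).trans ?_
      rw [muE_avgL]
      exact hβ i
    have st := (ent_lower h0 h1 _ s β hs hb).trans (lsi h0 h1 _)
    have e1 := pyth p i (avgL p l f)
    have e2 : ∀ k, muE n p (fun x => del n p k (del n p i (avgL p l f)) x ^ 2) =
        muE n p (fun x => avgL p l (del n p k f) x ^ 2) -
        muE n p (fun x => avgL p (i :: l) (del n p k f) x ^ 2) := by
      intro k
      rw [del_comm, del_avgL, pyth, avgL_cons]
    rw [e1] at st
    simp only [e2] at st
    rw [Finset.sum_sub_distrib] at st ih ⊢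
    simp only [avgL_cons, List.length_cons] at st ih ⊢
    push_cast
    linarith

lemma main_ineq {n : ℕ} {p : ℝ} (h0 : 0 < p) (h1 : p < 1) (f : (Fin n → Bool) → ℝ)
    (s β : ℝ) (hs : 0 < s) (hβ : ∀ i, muE n p (fun x => |del n p i f x|) ≤ β) :
    (muE n p (fun x => f x ^ 2) - muE n p f ^ 2) * (Real.log s + 1) - n * (s * β ^ 2) ≤
    16 * Real.log (2 / (p * (1 - p))) * ∑ k, muE n p (fun x => del n p k f x ^ 2) := by
  have h := main_list h0 h1 f s β hs hβ (List.finRange n)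
  simp only [avgL_all p _ (fun i => List.mem_finRange i), muE_const, List.length_finRange] at h
  refine h.trans ?_
  have hv : 0 < p * (1 - p) := mul_pos h0 (by linarith)
  have hL : 0 ≤ Real.log (2 / (p * (1 - p))) := by
    apply Real.log_nonneg
    rw [le_div_iff₀ hv]; nlinarith [sq_nonneg (p - 1 / 2)]
  gcongr with k
  have := sq_nonneg (muE n p (del n p k f))
  linarith

end Sharp

/-- Theorem 1.4: There is a universal `C > 0` such that for every `n ≥ 2`,
every nontrivial monotone symmetric `A ⊆ {0,1}^n` and every `p ∈ (0,1)`,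
`dμ_p(A)/dp ≥ C (log n / (p(1-p) log(2/(p(1-p))))) μ_p(A)(1-μ_p(A))`. -/
theorem stmt1 :
    ∃ C > (0 : ℝ), ∀ n : ℕ, 2 ≤ n → ∀ A : Finset (Fin n → Bool),
      MonotoneSet n A → SymmetricSet n A → A.Nonempty → A ≠ Finset.univ →
      ∀ p ∈ Set.Ioo (0 : ℝ) 1,
        deriv (fun q => muP n q A) p ≥
          C * (Real.log n / (p * (1 - p) * Real.log (2 / (p * (1 - p))))) *
            (muP n p A * (1 - muP n p A)) := by
  refine ⟨1 / 17, by norm_num, ?_⟩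
  intro n hn A hmono hsymm _ _ p hp
  obtain ⟨h0, h1⟩ := hp
  have hn0 : 0 < n := by omega
  set f : (Fin n → Bool) → ℝ := fun x => if x ∈ A then 1 else 0 with hf
  have hv : 0 < p * (1 - p) := mul_pos h0 (by linarith)
  have hv4 : p * (1 - p) ≤ 1 / 4 := by nlinarith [sq_nonneg (p - 1 / 2)]
  have hL : 2 ≤ Real.log (2 / (p * (1 - p))) := by
    have h8 : (8:ℝ) ≤ 2 / (p * (1 - p)) := by
      rw [le_div_iff₀ hv]; linarith
    have : Real.log 8 ≤ Real.log (2 / (p * (1 - p))) := Real.log_le_log (by norm_num) h8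
    have e : Real.log 8 = 3 * Real.log 2 := by
      rw [show (8:ℝ) = 2 ^ 3 by norm_num, Real.log_pow]; norm_num
    have := Real.log_two_gt_d9
    linarith
  set I : ℝ := muE n p (grad n ⟨0, hn0⟩ f) with hI
  have hIi : ∀ i, muE n p (grad n i f) = I := fun i => Sharp.grad_symm p A hsymm i _
  have hgrad : ∀ i x, grad n i f x = 0 ∨ grad n i f x = 1 := by
    intro i x
    simp only [grad, hf]
    by_cases ht : Function.update x i true ∈ A
    · by_cases hfa : Function.update x i false ∈ A <;> simp [ht, hfa]
    · have hfa : Function.update x i false ∉ A := by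
        intro h
        apply ht
        apply hmono _ h
        intro j
        by_cases hj : j = i
        · subst hj; simp
        · simp [hj]
      simp [ht, hfa]
  have hderiv : deriv (fun q => muP n q A) p = n * I := by
    rw [Sharp.russo]
    simp only [← hf]
    rw [Finset.sum_congr rfl (fun i _ => hIi i)]
    simp
  have hmu : muP n p A = muE n p f := by
    unfold muP muE
    simp [hf]
  have hf2 : muE n p (fun x => f x ^ 2) = muE n p f := by
    congr 1
    funext x
    simp only [hf]
    split_ifs <;> norm_num
  have hdel2 : ∀ k, muE n p (fun x => del n p k f x ^ 2) = p * (1 - p) * I := by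
    intro k
    rw [Sharp.del_sq, ← hIi k]
    congr 2
    funext x
    rcases hgrad k x with h | h <;> rw [h] <;> norm_num
  have hdel1 : ∀ k, muE n p (fun x => |del n p k f x|) ≤ 2 * (p * (1 - p)) * I := by
    intro k
    rw [Sharp.del_abs h0 h1, ← hIi k]
    apply le_of_eq
    congr 2
    funext x
    rcases hgrad k x with h | h <;> rw [h] <;> norm_num
  have hI0 : 0 ≤ I := by
    apply Sharp.muE_nonneg h0 h1
    intro x
    rcases hgrad ⟨0, hn0⟩ x with h | h <;> rw [h] <;> norm_num
  have hmain := fun s hs => Sharp.main_ineq h0 h1 f s _ hs hdel1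
  simp only [hdel2, hf2, Finset.sum_const, Finset.card_univ, Fintype.card_fin, nsmul_eq_mul] at hmain
  rw [hderiv, hmu]
  set m := muE n p f with hm
  have hm0 : 0 ≤ m := by
    apply Sharp.muE_nonneg h0 h1
    intro x
    simp only [hf]
    split_ifs <;> norm_num
  have hm1 : m ≤ 1 := by
    rw [← Sharp.muE_const (n := n) p 1]
    apply Sharp.muE_mono h0 h1
    intro x
    simp only [hf]
    split_ifs <;> norm_num
  set L := Real.log (2 / (p * (1 - p))) with hLdef
  set v := p * (1 - p) with hvdef
  have hV : 0 ≤ m * (1 - m) := mul_nonneg hm0 (by linarith)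
  have hV4 : 4 * (m * (1 - m)) ≤ 1 := by nlinarith [sq_nonneg (m - 1 / 2)]
  have hVe : m - m ^ 2 = m * (1 - m) := by ring
  rw [hVe] at hmain
  set V := m * (1 - m) with hVdef
  have hnR : (0:ℝ) < n := by exact_mod_cast hn0
  rcases hV.eq_or_lt with hVz | hVp
  · rw [← hVz, mul_zero]; positivity
  have hXpos : 0 < I := by
    rcases hI0.eq_or_lt with hz | hz
    · exfalso
      have := hmain 1 one_pos
      rw [← hz] at this
      simp at this
      linarith
    · exact hz
  set X := n * (v * I) with hX
  have hXp : 0 < X := by positivity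
  have hk := hmain (n * V / (4 * X ^ 2)) (by positivity)
  have e1 : (n:ℝ) * (n * V / (4 * X ^ 2) * (2 * v * I) ^ 2) = V := by
    rw [hX]; field_simp; ring
  rw [e1] at hk
  set t := X / V with ht
  have htp : 0 < t := by positivity
  have hXt : X = t * V := by rw [ht]; field_simp
  have hlog : Real.log n - 2 * Real.log t ≤ Real.log (n * V / (4 * X ^ 2)) := by
    have : Real.log n - 2 * Real.log t = Real.log (n / t ^ 2) := by
      rw [Real.log_div hnR.ne' (by positivity), Real.log_pow]; norm_num
    rw [this]
    apply Real.log_le_log (by positivity)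
    rw [div_le_div_iff₀ (by positivity) (by positivity), hXt]
    have : 0 ≤ (n:ℝ) * V * t ^ 2 := by positivity
    nlinarith
  have h5 : Real.log n - 2 * Real.log t ≤ 16 * L * t := by
    have h6 : V * (Real.log n - 2 * Real.log t) ≤ V * (16 * L * t) := by
      have := mul_le_mul_of_nonneg_left hlog hVp.le
      rw [hXt] at hk this
      linarith
    exact le_of_mul_le_mul_left h6 hVp
  have h7 : Real.log t ≤ t := (Real.log_le_sub_one_of_pos htp).trans (by linarith)
  have h8 : Real.log n ≤ 17 * L * t := by nlinarith
  have hLp : 0 < L := by linarith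
  have e9 : (n:ℝ) * I = t * V / v := by rw [← hXt, hX]; field_simp
  rw [ge_iff_le, e9]
  have e10 : 1 / 17 * (Real.log n / (v * L)) * V = (Real.log n / (17 * L)) * V / v := by
    field_simp
  rw [e10]
  gcongr
  rw [div_le_iff₀ (by positivity)]
  linarith
end

section
/- There exists a constant C > 0 such that, for every integer n ≥ 2, every nontrivial monotone symmetric subset A of {0,1}^n, and every ε ∈ (0,1/2), the threshold width satisfies τ(A,ε) ≤ C · sup_{p ∈ [p(ε), p(1−ε)]} { p(1−p) · log(2/(p(1−p))) } · log((1−ε)/ε) / log n. -/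
open Finset

section Helpers

lemma psi_bound (r R : ℝ) (hr : 0 ≤ r) (hrR : r ≤ R) (hR : 1 ≤ R) :
    2 * r ^ 2 * Real.log r - r ^ 2 + 1 ≤ (r - 1) ^ 2 * (3 + 2 * Real.log R) := by
  have hlR : 0 ≤ Real.log R := Real.log_nonneg hR
  have h0 : 0 ≤ (r - 1) ^ 2 * Real.log R := by positivity
  rcases le_or_gt (1 / 2) r with h | h
  · have hr0 : 0 < r := by linarith
    have h1 : Real.log r ≤ r - 1 := Real.log_le_sub_one_of_pos hr0
    have h2 : Real.log r ≤ Real.log R := Real.log_le_log hr0 hrR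
    have h3 : (4 * r - 2) * Real.log r ≤ (4 * r - 2) * (r - 1) :=
      mul_le_mul_of_nonneg_left h1 (by linarith)
    have h4 : (r - 1) ^ 2 * Real.log r ≤ (r - 1) ^ 2 * Real.log R :=
      mul_le_mul_of_nonneg_left h2 (by positivity)
    nlinarith
  · have h1 : Real.log r ≤ 0 := Real.log_nonpos hr (by linarith)
    have h2 : r ^ 2 * Real.log r ≤ 0 := mul_nonpos_of_nonneg_of_nonpos (by positivity) h1
    nlinarith

lemma psi_scaled (s e R : ℝ) (hs : 0 ≤ s) (he : 0 < e) (hsR : s ≤ R * e) (hR : 1 ≤ R) :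
    s ^ 2 * Real.log (s ^ 2) - s ^ 2 * Real.log (e ^ 2) - s ^ 2 + e ^ 2
      ≤ (s - e) ^ 2 * (3 + 2 * Real.log R) := by
  have h := psi_bound (s / e) R (by positivity) (by rwa [div_le_iff₀ he]) hR
  rcases hs.eq_or_lt with h0 | h0
  · subst h0
    have : 0 ≤ Real.log R := Real.log_nonneg hR
    have : 0 ≤ e ^ 2 * Real.log R := by positivity
    norm_num
    nlinarith [sq_nonneg e]
  · rw [Real.log_div h0.ne' he.ne'] at h
    have h2 := mul_le_mul_of_nonneg_left h (sq_nonneg e)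
    rw [Real.log_pow, Real.log_pow]
    have e1 : e ^ 2 * (2 * (s / e) ^ 2 * (Real.log s - Real.log e) - (s / e) ^ 2 + 1)
        = 2 * s ^ 2 * (Real.log s - Real.log e) - s ^ 2 + e ^ 2 := by field_simp
    have e2 : e ^ 2 * ((s / e - 1) ^ 2 * (3 + 2 * Real.log R))
        = (s - e) ^ 2 * (3 + 2 * Real.log R) := by field_simp
    rw [e1, e2] at h2
    push_cast
    linarith

/-- `v log v ≥ v log t + v - t`. -/
lemma xlogx_ge (v t : ℝ) (hv : 0 ≤ v) (ht : 0 < t) :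
    v * Real.log t + v - t ≤ v * Real.log v := by
  rcases hv.eq_or_lt with h0 | h0
  · subst h0; simp; linarith
  · have h := Real.log_le_sub_one_of_pos (div_pos ht h0)
    rw [Real.log_div ht.ne' h0.ne'] at h
    have h2 := mul_le_mul_of_nonneg_left h h0.le
    have : v * (t / v - 1) = t - v := by field_simp
    linarith

lemma twopoint_lsi (p : ℝ) (hp : 0 < p) (hp1 : p < 1) (s t : ℝ) :
    p * (s ^ 2 * Real.log (s ^ 2)) + (1 - p) * (t ^ 2 * Real.log (t ^ 2))
      - (p * s ^ 2 + (1 - p) * t ^ 2) * Real.log (p * s ^ 2 + (1 - p) * t ^ 2)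
    ≤ (3 + 2 * Real.log (1 / (p * (1 - p)))) * (p * (1 - p) * (s - t) ^ 2) := by
  have hq : 0 < 1 - p := by linarith
  have hpq : 0 < p * (1 - p) := mul_pos hp hq
  have hR : 1 ≤ 1 / (p * (1 - p)) := by
    rw [le_div_iff₀ hpq]; nlinarith
  have hlR := Real.log_nonneg hR
  set R := 1 / (p * (1 - p)) with hRdef
  have key : ∀ s t : ℝ, 0 ≤ s → 0 ≤ t →
    p * (s ^ 2 * Real.log (s ^ 2)) + (1 - p) * (t ^ 2 * Real.log (t ^ 2))
      - (p * s ^ 2 + (1 - p) * t ^ 2) * Real.log (p * s ^ 2 + (1 - p) * t ^ 2)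
    ≤ (3 + 2 * Real.log R) * (p * (1 - p) * (s - t) ^ 2) := by
    intro s t hs ht
    have h1 : 0 ≤ p * s := by positivity
    have h2 : 0 ≤ (1 - p) * t := by positivity
    rcases (add_nonneg h1 h2).eq_or_lt with h0 | he
    · have h3 : s = 0 := by
        have : p * s = 0 := by linarith
        rcases mul_eq_zero.1 this with h | h
        · linarith
        · exact h
      have h4 : t = 0 := by
        have : (1 - p) * t = 0 := by linarith
        rcases mul_eq_zero.1 this with h | h
        · linarith
        · exact h
      subst h3 h4
      simp
    · set e := p * s + (1 - p) * t with hedef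
      have hRp : R * p ≥ 1 := by
        rw [hRdef]
        have : 1 / (p * (1 - p)) * p = 1 / (1 - p) := by field_simp
        rw [this, ge_iff_le, le_div_iff₀ hq]; linarith
      have hRq : R * (1 - p) ≥ 1 := by
        rw [hRdef]
        have : 1 / (p * (1 - p)) * (1 - p) = 1 / p := by field_simp
        rw [this, ge_iff_le, le_div_iff₀ hp]; linarith
      have hR0 : 0 < R := by linarith
      have hs1 : s ≤ R * e := by
        have : 0 ≤ R * ((1 - p) * t) := by positivity
        nlinarith
      have ht1 : t ≤ R * e := by
        have : 0 ≤ R * (p * s) := by positivity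
        nlinarith
      have k1 := psi_scaled s e R hs he hs1 hR
      have k2 := psi_scaled t e R ht he ht1 hR
      have k3 := xlogx_ge (p * s ^ 2 + (1 - p) * t ^ 2) (e ^ 2) (by positivity) (by positivity)
      have k1' := mul_le_mul_of_nonneg_left k1 hp.le
      have k2' := mul_le_mul_of_nonneg_left k2 hq.le
      have e1 : s - e = (1 - p) * (s - t) := by rw [hedef]; ring
      have e2 : t - e = - p * (s - t) := by rw [hedef]; ring
      rw [e1] at k1'
      rw [e2] at k2'
      have : (3 + 2 * Real.log R) * (p * (1 - p) * (s - t) ^ 2)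
        = p * (((1 - p) * (s - t)) ^ 2 * (3 + 2 * Real.log R))
          + (1 - p) * ((- p * (s - t)) ^ 2 * (3 + 2 * Real.log R)) := by ring
      rw [this]
      linarith
  have h := key |s| |t| (abs_nonneg s) (abs_nonneg t)
  simp only [sq_abs] at h
  refine h.trans ?_
  apply mul_le_mul_of_nonneg_left _ (by linarith)
  apply mul_le_mul_of_nonneg_left _ hpq.le
  rw [sub_sq, sub_sq, sq_abs, sq_abs]
  have : s * t ≤ |s| * |t| := by rw [← abs_mul]; exact le_abs_self _
  linarith

lemma gibbs_term (a α m γ : ℝ) (ha : 0 ≤ a) (hα : 0 ≤ α) (hm : 0 < m) (hγ : 0 < γ)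
    (h : α = 0 → a = 0) :
    a * (Real.log α - Real.log γ) ≤ a * Real.log a - a * Real.log m + (α * m / γ - a) := by
  rcases ha.eq_or_lt with h0 | h0
  · subst h0
    have : 0 ≤ α * m / γ := by positivity
    simpa using this
  · have hα0 : 0 < α := by
      rcases hα.eq_or_lt with h1 | h1
      · exact absurd (h h1.symm) h0.ne'
      · exact h1
    have k := xlogx_ge a (α * m / γ) ha (by positivity)
    rw [Real.log_div (by positivity) hγ.ne', Real.log_mul hα0.ne' hm.ne'] at k
    linarith

lemma twopoint_gibbs (p : ℝ) (hp : 0 < p) (hp1 : p < 1) (a b α β : ℝ)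
    (ha : 0 ≤ a) (hb : 0 ≤ b) (hα : 0 ≤ α) (hβ : 0 ≤ β) (h1 : α = 0 → a = 0) (h2 : β = 0 → b = 0) :
    p * (a * (Real.log α - Real.log (p * α + (1 - p) * β)))
      + (1 - p) * (b * (Real.log β - Real.log (p * α + (1 - p) * β)))
    ≤ p * (a * Real.log a) + (1 - p) * (b * Real.log b)
      - (p * a + (1 - p) * b) * Real.log (p * a + (1 - p) * b) := by
  have hq : 0 < 1 - p := by linarith
  have hm : 0 ≤ p * a + (1 - p) * b := by positivity
  rcases hm.eq_or_lt with h0 | h0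
  · have h3 : a = 0 := by
      have : p * a = 0 := by
        have : 0 ≤ p * a := by positivity
        have : 0 ≤ (1 - p) * b := by positivity
        linarith
      rcases mul_eq_zero.1 this with h | h
      · linarith
      · exact h
    subst h3
    have h4 : b = 0 := by
      have : (1 - p) * b = 0 := by linarith
      rcases mul_eq_zero.1 this with h | h
      · linarith
      · exact h
    subst h4
    simp
  · have hγ : 0 < p * α + (1 - p) * β := by
      by_contra hcon
      have t1 : 0 ≤ p * α := by positivity
      have t2 : 0 ≤ (1 - p) * β := by positivity
      have h3 : α = 0 := by
        have : p * α = 0 := by linarith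
        rcases mul_eq_zero.1 this with h | h
        · linarith
        · exact h
      have h4 : β = 0 := by
        have : (1 - p) * β = 0 := by linarith
        rcases mul_eq_zero.1 this with h | h
        · linarith
        · exact h
      rw [h1 h3, h2 h4] at h0
      simp at h0
    set m := p * a + (1 - p) * b
    set γ := p * α + (1 - p) * β with hg
    have k1 := mul_le_mul_of_nonneg_left (gibbs_term a α m γ ha hα h0 hγ h1) hp.le
    have k2 := mul_le_mul_of_nonneg_left (gibbs_term b β m γ hb hβ h0 hγ h2) hq.le
    have e : p * (α * m / γ) + (1 - p) * (β * m / γ) = m := by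
      have : p * (α * m / γ) + (1 - p) * (β * m / γ) = (p * α + (1 - p) * β) * m / γ := by ring
      rw [this, ← hg]; field_simp
    have e2 : m = p * a + (1 - p) * b := rfl
    have e3 : m * Real.log m = p * (a * Real.log m) + (1 - p) * (b * Real.log m) := by
      rw [e2]; ring
    rw [e3]
    linarith

end Helpers

section Operators

variable {n : ℕ} {p : ℝ}

/-- averaging over coordinate `i` -/
noncomputable def av (p : ℝ) (i : Fin n) (f : (Fin n → Bool) → ℝ) (x : Fin n → Bool) : ℝ :=
  p * f (Function.update x i true) + (1 - p) * f (Function.update x i false)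

/-- averaging over coordinates `0, …, k-1` -/
noncomputable def Mav (p : ℝ) (f : (Fin n → Bool) → ℝ) : ℕ → (Fin n → Bool) → ℝ
  | 0 => f
  | k + 1 => if h : k < n then av p ⟨k, h⟩ (Mav p f k) else Mav p f k

lemma Mav_zero (f : (Fin n → Bool) → ℝ) : Mav p f 0 = f := rfl

lemma Mav_succ (f : (Fin n → Bool) → ℝ) (k : Fin n) :
    Mav p f (k + 1) = av p k (Mav p f k) := by
  simp [Mav]

lemma Mav_succ_nat (f : (Fin n → Bool) → ℝ) (k : ℕ) (h : k < n) :
    Mav p f (k + 1) = av p ⟨k, h⟩ (Mav p f k) := by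
  simp [Mav, h]

lemma muE_split {m : ℕ} (i : Fin (m + 1)) (f : (Fin (m + 1) → Bool) → ℝ) :
    muE (m + 1) p f = ∑ y : Fin m → Bool, muW m p y *
      (p * f (i.insertNth true y) + (1 - p) * f (i.insertNth false y)) := by
  unfold muE
  rw [← (Fin.insertNthEquiv (fun _ => Bool) i).sum_comp]
  rw [Fintype.sum_prod_type_right]
  refine Finset.sum_congr rfl fun y _ => ?_
  simp [muW, Fin.prod_univ_succAbove _ i, Fin.insertNthEquiv]
  ring

lemma muE_av (i : Fin n) (f : (Fin n → Bool) → ℝ) : muE n p (av p i f) = muE n p f := by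
  obtain ⟨m, rfl⟩ : ∃ m, n = m + 1 := ⟨n - 1, by have := i.pos; omega⟩
  rw [muE_split i, muE_split i]
  refine Finset.sum_congr rfl fun y _ => ?_
  simp only [av, Fin.update_insertNth]
  ring

lemma muE_add (f g : (Fin n → Bool) → ℝ) :
    muE n p (fun x => f x + g x) = muE n p f + muE n p g := by
  simp [muE, mul_add, Finset.sum_add_distrib]

lemma muE_sub (f g : (Fin n → Bool) → ℝ) :
    muE n p (fun x => f x - g x) = muE n p f - muE n p g := by
  simp [muE, mul_sub, Finset.sum_sub_distrib]

lemma muE_smul (c : ℝ) (f : (Fin n → Bool) → ℝ) :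
    muE n p (fun x => c * f x) = c * muE n p f := by
  simp only [muE, Finset.mul_sum]
  exact Finset.sum_congr rfl fun x _ => by ring

lemma muW_pos (hp : 0 < p) (hp1 : p < 1) (x : Fin n → Bool) : 0 < muW n p x := by
  unfold muW
  refine Finset.prod_pos fun i _ => ?_
  split_ifs <;> linarith

lemma muE_mono (hp : 0 < p) (hp1 : p < 1) {f g : (Fin n → Bool) → ℝ} (h : ∀ x, f x ≤ g x) :
    muE n p f ≤ muE n p g :=
  Finset.sum_le_sum fun x _ => mul_le_mul_of_nonneg_left (h x) (muW_pos hp hp1 x).le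

lemma muE_nonneg (hp : 0 < p) (hp1 : p < 1) {f : (Fin n → Bool) → ℝ} (h : ∀ x, 0 ≤ f x) :
    0 ≤ muE n p f :=
  Finset.sum_nonneg fun x _ => mul_nonneg (muW_pos hp hp1 x).le (h x)

lemma muE_one : muE n p (fun _ => 1) = 1 := by
  induction n with
  | zero => simp [muE, muW]
  | succ m ih =>
    rw [muE_split 0]
    simp only [mul_one, add_sub_cancel]
    simpa [muE] using ih

lemma muE_const (c : ℝ) : muE n p (fun _ => c) = c := by
  have := muE_smul (n := n) (p := p) c (fun _ => 1)
  simpa [muE_one] using this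

lemma muE_zero_of (hp : 0 < p) (hp1 : p < 1) {f : (Fin n → Bool) → ℝ} (h : ∀ x, 0 ≤ f x)
    (h0 : muE n p f = 0) (x : Fin n → Bool) : f x = 0 := by
  unfold muE at h0
  rw [Finset.sum_eq_zero_iff_of_nonneg
    (fun x _ => mul_nonneg (muW_pos hp hp1 x).le (h x))] at h0
  have := h0 x (Finset.mem_univ x)
  rcases mul_eq_zero.1 this with h | h
  · exact absurd h (muW_pos hp hp1 x).ne'
  · exact h

lemma av_update (i : Fin n) (f : (Fin n → Bool) → ℝ) (x : Fin n → Bool) (b : Bool) :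
    av p i f (Function.update x i b) = av p i f x := by
  simp [av]

lemma av_comm (i j : Fin n) (f : (Fin n → Bool) → ℝ) :
    av p i (av p j f) = av p j (av p i f) := by
  by_cases hij : i = j
  · rw [hij]
  · funext x
    simp only [av]
    have h : ∀ b c : Bool, Function.update (Function.update x i b) j c
        = Function.update (Function.update x j c) i b := fun b c =>
      Function.update_comm hij b c x
    simp only [h]
    ring

lemma av_sub (i : Fin n) (f g : (Fin n → Bool) → ℝ) :
    av p i (fun x => f x - g x) = fun x => av p i f x - av p i g x := by
  funext x; simp only [av]; ring

lemma Mav_sub (f g : (Fin n → Bool) → ℝ) (k : ℕ) :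
    Mav p (fun x => f x - g x) k = fun x => Mav p f k x - Mav p g k x := by
  induction k with
  | zero => rfl
  | succ k ih =>
    by_cases h : k < n
    · simp only [Mav_succ_nat _ k h]
      rw [ih, av_sub]
    · simp [Mav, h, ih]

lemma Mav_av (i : Fin n) (f : (Fin n → Bool) → ℝ) (k : ℕ) :
    Mav p (av p i f) k = av p i (Mav p f k) := by
  induction k with
  | zero => rfl
  | succ k ih =>
    by_cases h : k < n
    · simp only [Mav_succ_nat _ k h]
      rw [ih, av_comm]
    · simp [Mav, h, ih]

lemma muE_Mav (f : (Fin n → Bool) → ℝ) (k : ℕ) : muE n p (Mav p f k) = muE n p f := by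
  induction k with
  | zero => rfl
  | succ k ih =>
    by_cases h : k < n
    · rw [Mav_succ_nat _ k h, muE_av, ih]
    · simp [Mav, h, ih]

lemma del_eq (i : Fin n) (f : (Fin n → Bool) → ℝ) :
    del n p i f = fun x => f x - av p i f x := rfl

lemma Mav_del (i : Fin n) (f : (Fin n → Bool) → ℝ) (k : ℕ) :
    Mav p (del n p i f) k = del n p i (Mav p f k) := by
  rw [del_eq, Mav_sub, Mav_av]; rfl

lemma Mav_update (f : (Fin n → Bool) → ℝ) (k : ℕ) (i : Fin n) (hi : (i : ℕ) < k)
    (x : Fin n → Bool) (b : Bool) :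
    Mav p f k (Function.update x i b) = Mav p f k x := by
  induction k generalizing x with
  | zero => omega
  | succ k ih =>
    by_cases h : k < n
    · rw [Mav_succ_nat _ k h]
      by_cases hk : i = ⟨k, h⟩
      · rw [hk, av_update]
      · have hik : (i : ℕ) < k := by
          have : (i : ℕ) ≠ k := fun h' => hk (Fin.ext h')
          omega
        simp only [av]
        rw [Function.update_comm hk, Function.update_comm hk, ih hik, ih hik]
    · have : (i : ℕ) < k := by have := i.2; omega
      simp only [Mav, h]
      exact ih this x

lemma const_of_update (F : (Fin n → Bool) → ℝ)
    (hF : ∀ i x b, F (Function.update x i b) = F x) (x y : Fin n → Bool) : F x = F y := by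
  have : ∀ s : Finset (Fin n), F (s.piecewise y x) = F x := by
    intro s
    induction s using Finset.induction_on with
    | empty => simp
    | insert j s _ ih => rw [Finset.piecewise_insert, hF, ih]
  rw [← this Finset.univ]; simp

lemma Mav_last (f : (Fin n → Bool) → ℝ) (x : Fin n → Bool) : Mav p f n x = muE n p f := by
  rw [← muE_Mav f n]
  have : Mav p f n = fun _ => Mav p f n x := by
    funext y
    exact const_of_update _ (fun i x b => Mav_update f n i i.2 x b) y x
  rw [this, muE_const]

lemma Mav_nonneg (hp : 0 < p) (hp1 : p < 1) {f : (Fin n → Bool) → ℝ} (h : ∀ x, 0 ≤ f x) (k : ℕ)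
    (x : Fin n → Bool) : 0 ≤ Mav p f k x := by
  induction k generalizing x with
  | zero => exact h x
  | succ k ih =>
    by_cases hk : k < n
    · rw [Mav_succ_nat _ k hk]
      exact add_nonneg (mul_nonneg hp.le (ih _)) (mul_nonneg (by linarith) (ih _))
    · simp only [Mav, hk]; exact ih x

lemma av_zero_imp (hp : 0 < p) (hp1 : p < 1) {f : (Fin n → Bool) → ℝ} (h : ∀ x, 0 ≤ f x)
    (i : Fin n) (x : Fin n → Bool) (h0 : av p i f x = 0) : f x = 0 := by
  have t1 : 0 ≤ p * f (Function.update x i true) := mul_nonneg hp.le (h _)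
  have t2 : 0 ≤ (1 - p) * f (Function.update x i false) := mul_nonneg (by linarith) (h _)
  unfold av at h0
  cases hx : x i
  · have : (1 - p) * f (Function.update x i false) = 0 := by linarith
    rw [← hx, Function.update_eq_self] at this
    rcases mul_eq_zero.1 this with h | h
    · linarith
    · exact h
  · have : p * f (Function.update x i true) = 0 := by linarith
    rw [← hx, Function.update_eq_self] at this
    rcases mul_eq_zero.1 this with h | h
    · linarith
    · exact h

lemma Mav_zero_imp (hp : 0 < p) (hp1 : p < 1) {f : (Fin n → Bool) → ℝ} (h : ∀ x, 0 ≤ f x) (k : ℕ)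
    (x : Fin n → Bool) (h0 : Mav p f k x = 0) : f x = 0 := by
  induction k generalizing x with
  | zero => exact h0
  | succ k ih =>
    by_cases hk : k < n
    · rw [Mav_succ_nat _ k hk] at h0
      exact ih x (av_zero_imp hp hp1 (Mav_nonneg hp hp1 h k) _ x h0)
    · simp only [Mav, hk] at h0; exact ih x h0

lemma Mav_abs_le (hp : 0 < p) (hp1 : p < 1) (f : (Fin n → Bool) → ℝ) (k : ℕ)
    (x : Fin n → Bool) : |Mav p f k x| ≤ Mav p (fun y => |f y|) k x := by
  induction k generalizing x with
  | zero => exact le_rfl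
  | succ k ih =>
    by_cases hk : k < n
    · rw [Mav_succ_nat _ k hk, Mav_succ_nat _ k hk]
      unfold av
      refine (abs_add_le _ _).trans ?_
      rw [abs_mul, abs_mul, abs_of_pos hp, abs_of_pos (show 0 < 1 - p by linarith)]
      exact add_le_add (mul_le_mul_of_nonneg_left (ih _) hp.le)
        (mul_le_mul_of_nonneg_left (ih _) (by linarith))
    · simp only [Mav, hk]; exact ih x

lemma av_del_sq (i : Fin n) (f : (Fin n → Bool) → ℝ) (x : Fin n → Bool) :
    av p i (fun y => del n p i f y ^ 2) x
      = p * (1 - p) * (f (Function.update x i true) - f (Function.update x i false)) ^ 2 := by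
  simp only [av, del, Function.update_idem]
  ring

lemma muE_del_sq (i : Fin n) (f : (Fin n → Bool) → ℝ) :
    muE n p (fun x => del n p i f x ^ 2) = p * (1 - p) * muE n p (fun x => grad n i f x ^ 2) := by
  rw [← muE_av i, ← muE_smul]
  congr 1
  funext x
  rw [av_del_sq]; rfl

lemma muE_del_abs (hp : 0 < p) (hp1 : p < 1) (i : Fin n) (f : (Fin n → Bool) → ℝ) :
    muE n p (fun x => |del n p i f x|) = 2 * (p * (1 - p)) * muE n p (fun x => |grad n i f x|) := by
  rw [← muE_av i, ← muE_smul]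
  congr 1
  funext x
  simp only [av, del, grad, Function.update_idem]
  set s := f (Function.update x i true)
  set t := f (Function.update x i false)
  have e1 : s - (p * s + (1 - p) * t) = (1 - p) * (s - t) := by ring
  have e2 : t - (p * s + (1 - p) * t) = (-p) * (s - t) := by ring
  rw [e1, e2, abs_mul, abs_mul, abs_neg, abs_of_pos hp, abs_of_pos (show 0 < 1 - p by linarith)]
  ring

/-- Pythagoras for one coordinate. -/
lemma muE_del_pyth (i : Fin n) (f : (Fin n → Bool) → ℝ) :
    muE n p (fun x => del n p i f x ^ 2)
      = muE n p (fun x => f x ^ 2) - muE n p (fun x => av p i f x ^ 2) := by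
  rw [← muE_sub, ← muE_av i, ← muE_av i (fun x => f x ^ 2 - av p i f x ^ 2)]
  congr 1
  funext x
  simp only [av, del, Function.update_idem]
  ring

lemma muE_del_Mav (i : Fin n) (f : (Fin n → Bool) → ℝ) :
    muE n p (fun x => del n p i (Mav p f i) x ^ 2)
      = muE n p (fun x => Mav p f i x ^ 2) - muE n p (fun x => Mav p f (i + 1) x ^ 2) := by
  rw [muE_del_pyth, Mav_succ]

lemma sum_del_Mav (f : (Fin n → Bool) → ℝ) :
    ∑ i : Fin n, muE n p (fun x => del n p i (Mav p f i) x ^ 2)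
      = muE n p (fun x => f x ^ 2) - (muE n p f) ^ 2 := by
  simp only [muE_del_Mav]
  rw [Fin.sum_univ_eq_sum_range (fun k => muE n p (fun x => Mav p f k x ^ 2)
    - muE n p (fun x => Mav p f (k + 1) x ^ 2)), Finset.sum_range_sub']
  simp only [Mav_last, muE_const, Mav_zero]

lemma muE_Mav_sq_le (hp : 0 < p) (hp1 : p < 1) (f : (Fin n → Bool) → ℝ) (k : ℕ) :
    muE n p (fun x => Mav p f k x ^ 2) ≤ muE n p (fun x => f x ^ 2) := by
  induction k with
  | zero => exact le_rfl
  | succ k ih =>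
    by_cases hk : k < n
    · have := muE_del_Mav (p := p) ⟨k, hk⟩ f
      have h0 := muE_nonneg (f := fun x => del n p ⟨k, hk⟩ (Mav p f k) x ^ 2) hp hp1
        (fun x => sq_nonneg _)
      simp only at this
      linarith
    · simp only [Mav, hk]; exact ih

lemma lsi (hp : 0 < p) (hp1 : p < 1) (g : (Fin n → Bool) → ℝ) :
    muE n p (fun x => g x ^ 2 * Real.log (g x ^ 2))
      - muE n p (fun x => g x ^ 2) * Real.log (muE n p (fun x => g x ^ 2))
    ≤ (3 + 2 * Real.log (1 / (p * (1 - p)))) * ∑ i, muE n p (fun x => del n p i g x ^ 2) := by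
  set u : (Fin n → Bool) → ℝ := fun x => g x ^ 2 with hu
  have hu0 : ∀ x, 0 ≤ u x := fun x => sq_nonneg _
  have tel : ∑ i : Fin n, muE n p (fun x => u x * (Real.log (Mav p u i x)
        - Real.log (Mav p u (i + 1) x)))
      = muE n p (fun x => u x * Real.log (u x)) - muE n p u * Real.log (muE n p u) := by
    simp only [mul_sub, muE_sub]
    rw [Fin.sum_univ_eq_sum_range (fun k => muE n p (fun x => u x * Real.log (Mav p u k x))
      - muE n p (fun x => u x * Real.log (Mav p u (k + 1) x))), Finset.sum_range_sub']
    simp only [Mav_last, Mav_zero]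
    congr 1
    rw [mul_comm (muE n p u), ← muE_smul]
    congr 1
    funext x
    ring
  rw [← tel, Finset.mul_sum]
  refine Finset.sum_le_sum fun i _ => ?_
  rw [← muE_av i, ← muE_av i (fun x => del n p i g x ^ 2), ← muE_smul]
  refine muE_mono hp hp1 fun x => ?_
  rw [av_del_sq]
  refine le_trans ?_ (twopoint_lsi p hp hp1 _ _)
  have := twopoint_gibbs p hp hp1 (u (Function.update x i true)) (u (Function.update x i false))
    (Mav p u i (Function.update x i true)) (Mav p u i (Function.update x i false))
    (hu0 _) (hu0 _) (Mav_nonneg hp hp1 hu0 _ _) (Mav_nonneg hp hp1 hu0 _ _)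
    (Mav_zero_imp hp hp1 hu0 _ _) (Mav_zero_imp hp hp1 hu0 _ _)
  refine le_trans (le_of_eq ?_) this
  rw [Mav_succ]
  simp only [av, Function.update_idem]

/-- Entropy lower bound. -/
lemma ent_lower (hp : 0 < p) (hp1 : p < 1) (g : (Fin n → Bool) → ℝ) (a : ℝ) (ha : 0 < a)
    (hga : muE n p (fun x => |g x|) ≤ a) :
    muE n p (fun x => g x ^ 2) * Real.log (muE n p (fun x => g x ^ 2))
      - muE n p (fun x => g x ^ 2) * (2 * Real.log a)
    ≤ muE n p (fun x => g x ^ 2 * Real.log (g x ^ 2))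
      - muE n p (fun x => g x ^ 2) * Real.log (muE n p (fun x => g x ^ 2)) := by
  set v := muE n p (fun x => g x ^ 2) with hv
  have hv0 : 0 ≤ v := muE_nonneg hp hp1 fun x => sq_nonneg _
  rcases hv0.eq_or_lt with h0 | h0
  · have hz : ∀ x, g x ^ 2 = 0 :=
      muE_zero_of hp hp1 (fun x => sq_nonneg _) (by rw [← hv, ← h0])
    rw [← h0]
    simp [hz, muE_const]
  · skip
    have pt : ∀ x, 2 * (Real.log v - Real.log a) * g x ^ 2 + (2 * g x ^ 2 - 2 * (v / a) * |g x|)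
        ≤ g x ^ 2 * Real.log (g x ^ 2) := by
      intro x
      have k := xlogx_ge (|g x|) (v / a) (abs_nonneg _) (by positivity)
      rw [Real.log_div h0.ne' ha.ne'] at k
      have k2 := mul_le_mul_of_nonneg_left k (abs_nonneg (g x))
      have e1 : Real.log (g x ^ 2) = 2 * Real.log |g x| := by
        rw [← sq_abs, Real.log_pow]; push_cast; ring
      rw [e1, ← sq_abs (g x)]
      nlinarith
    have h1 := muE_mono hp hp1 pt
    rw [muE_add, muE_sub, muE_smul, muE_smul, muE_smul, ← hv] at h1
    have h2 : v / a * muE n p (fun x => |g x|) ≤ v := by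
      calc v / a * muE n p (fun x => |g x|) ≤ v / a * a :=
            mul_le_mul_of_nonneg_left hga (by positivity)
        _ = v := by field_simp
    linarith

/-- Main inequality (Falik–Samorodnitsky / Rossignol). -/
lemma main_ineq (hn : 1 ≤ n) (hp : 0 < p) (hp1 : p < 1) (f : (Fin n → Bool) → ℝ) (J : ℝ)
    (hJ1 : ∀ i, muE n p (fun x => |grad n i f x|) = J)
    (hJ2 : ∀ i, muE n p (fun x => grad n i f x ^ 2) = J)
    (V : ℝ) (hV : V = muE n p (fun x => f x ^ 2) - (muE n p f) ^ 2) (hV0 : 0 < V)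
    (hV1 : V ≤ 1 / 4) :
    V * Real.log n ≤ (5 + 2 * Real.log (1 / (p * (1 - p)))) * (p * (1 - p) * (n * J)) := by
  have hq : 0 < 1 - p := by linarith
  have hpq : 0 < p * (1 - p) := mul_pos hp hq
  have hn0 : (0 : ℝ) < n := by exact_mod_cast hn
  set L := 3 + 2 * Real.log (1 / (p * (1 - p))) with hL
  set W : Fin n → (Fin n → Bool) → ℝ := fun j => del n p j (Mav p f j) with hW
  set v : Fin n → ℝ := fun j => muE n p (fun x => W j x ^ 2) with hv
  have hvsum : ∑ j, v j = V := by rw [hV]; exact sum_del_Mav f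
  have hv0 : ∀ j, 0 ≤ v j := fun j => muE_nonneg hp hp1 fun x => sq_nonneg _
  have hvle : ∀ j, v j ≤ p * (1 - p) * J := by
    intro j
    have := muE_Mav_sq_le hp hp1 (del n p j f) j
    rw [muE_del_sq j f, hJ2, Mav_del] at this
    exact this
  have hVle : V ≤ p * (1 - p) * (n * J) := by
    rw [← hvsum]
    calc ∑ j, v j ≤ ∑ j : Fin n, p * (1 - p) * J := Finset.sum_le_sum fun j _ => hvle j
      _ = _ := by simp; ring
  have hY0 : 0 < p * (1 - p) * (n * J) := lt_of_lt_of_le hV0 hVle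
  set Y := p * (1 - p) * (n * J) with hY
  set a := 2 * (p * (1 - p)) * J with ha
  have haY : a = 2 * Y / n := by rw [ha, hY]; field_simp
  have ha0 : 0 < a := by rw [haY]; positivity
  have hWa : ∀ j, muE n p (fun x => |W j x|) ≤ a := by
    intro j
    rw [ha, ← hJ1 j, ← muE_del_abs hp hp1, ← muE_Mav (fun x => |del n p j f x|) j]
    refine muE_mono hp hp1 fun x => ?_
    have := Mav_abs_le hp hp1 (del n p j f) j x
    rwa [Mav_del] at this
  have step : ∀ j, v j * Real.log (v j) - v j * (2 * Real.log a)
      ≤ L * ∑ i, muE n p (fun x => del n p i (W j) x ^ 2) := fun j =>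
    (ent_lower hp hp1 (W j) a ha0 (hWa j)).trans (lsi hp hp1 (W j))
  have comm : ∀ i j, del n p i (W j) = del n p j (Mav p (del n p i f) j) := by
    intro i j
    rw [Mav_del]
    simp only [hW, del_eq, av_sub]
    rw [av_comm i j]
    funext x
    ring
  have dsum : ∑ j, ∑ i, muE n p (fun x => del n p i (W j) x ^ 2) ≤ Y := by
    rw [Finset.sum_comm]
    calc ∑ i, ∑ j, muE n p (fun x => del n p i (W j) x ^ 2)
        ≤ ∑ i : Fin n, p * (1 - p) * J := by
          refine Finset.sum_le_sum fun i _ => ?_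
          simp only [comm]
          rw [sum_del_Mav, muE_del_sq, hJ2]
          linarith [sq_nonneg (muE n p (del n p i f))]
      _ = Y := by simp [hY]; ring
  have hL0 : 0 ≤ L := by
    have : 0 ≤ Real.log (1 / (p * (1 - p))) := by
      apply Real.log_nonneg
      rw [le_div_iff₀ hpq]; nlinarith
    linarith
  have h1 : ∑ j, (v j * Real.log (v j) - v j * (2 * Real.log a)) ≤ L * Y := by
    refine (Finset.sum_le_sum fun j _ => step j).trans ?_
    rw [← Finset.mul_sum]
    exact mul_le_mul_of_nonneg_left dsum hL0
  have h2 : ∑ j, (v j * Real.log (V / n) + v j - V / n) ≤ ∑ j, v j * Real.log (v j) :=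
    Finset.sum_le_sum fun j _ => xlogx_ge _ _ (hv0 j) (by positivity)
  rw [Finset.sum_sub_distrib, ← Finset.sum_mul, hvsum] at h1
  rw [Finset.sum_sub_distrib, Finset.sum_add_distrib, ← Finset.sum_mul, hvsum] at h2
  simp only [Finset.sum_const, Finset.card_univ, Fintype.card_fin, nsmul_eq_mul] at h2
  have e0 : (n : ℝ) * (V / n) = V := by field_simp
  rw [e0] at h2
  have h3 : V * Real.log (V / n) - V * (2 * Real.log a) ≤ L * Y := by linarith
  rw [haY, Real.log_div hV0.ne' hn0.ne', Real.log_div (by positivity) hn0.ne',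
    Real.log_mul (by norm_num) hY0.ne'] at h3
  have h4 : Real.log Y - Real.log V ≤ Y / V - 1 := by
    rw [← Real.log_div hY0.ne' hV0.ne']
    exact Real.log_le_sub_one_of_pos (by positivity)
  have h5 : Real.log V ≤ - (2 * Real.log 2) := by
    have : Real.log V ≤ Real.log (1 / 4) := Real.log_le_log hV0 hV1
    have e : Real.log (1 / 4) = - (2 * Real.log 2) := by
      rw [one_div, Real.log_inv, show (4 : ℝ) = 2 ^ 2 by norm_num, Real.log_pow]; push_cast; ring
    linarith
  have h6 : V * (Real.log Y - Real.log V) ≤ Y := by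
    calc V * (Real.log Y - Real.log V) ≤ V * (Y / V - 1) := mul_le_mul_of_nonneg_left h4 hV0.le
      _ = Y - V := by field_simp
      _ ≤ Y := by linarith
  have h7 := mul_le_mul_of_nonneg_left h5 hV0.le
  have : (5 + 2 * Real.log (1 / (p * (1 - p)))) * Y = L * Y + 2 * Y := by rw [hL]; ring
  rw [this]
  linarith

end Operators

section Sets

variable {n : ℕ} {p : ℝ}

open Classical in
/-- indicator -/
noncomputable def indA (A : Finset (Fin n → Bool)) (x : Fin n → Bool) : ℝ := if x ∈ A then 1 else 0

lemma muP_eq (A : Finset (Fin n → Bool)) : muP n p A = muE n p (indA A) := by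
  simp [muP, muE, indA, Finset.sum_ite_mem]

lemma muE_hasDeriv (f : (Fin n → Bool) → ℝ) :
    HasDerivAt (fun p => muE n p f) (∑ i, muE n p (grad n i f)) p := by
  have hw : ∀ x : Fin n → Bool, HasDerivAt (fun p => muW n p x)
      (∑ i, (∏ j ∈ Finset.univ.erase i, if x j then p else 1 - p) * (if x i then 1 else -1)) p := by
    intro x
    have := HasDerivAt.fun_finsetProd (u := (Finset.univ : Finset (Fin n))) (x := p)
      (f := fun i p => if x i then p else 1 - p) (f' := fun i => if x i then 1 else -1)
      (fun i _ => by
        by_cases h : x i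
        · simpa [h] using hasDerivAt_id' p
        · simpa [h] using (hasDerivAt_id' p).const_sub 1)
    simpa [muW, smul_eq_mul] using this
  have h2 : HasDerivAt (fun p => muE n p f) (∑ x : Fin n → Bool,
      (∑ i, (∏ j ∈ Finset.univ.erase i, if x j then p else 1 - p) * (if x i then 1 else -1)) * f x)
      p := by
    unfold muE
    exact HasDerivAt.fun_sum fun x _ => (hw x).mul_const _
  convert h2 using 1
  simp only [Finset.sum_mul]
  rw [Finset.sum_comm]
  refine Finset.sum_congr rfl fun i _ => ?_
  obtain ⟨m, rfl⟩ : ∃ m, n = m + 1 := ⟨n - 1, by have := i.pos; omega⟩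
  rw [muE_split i, ← (Fin.insertNthEquiv (fun _ => Bool) i).sum_comp, Fintype.sum_prod_type_right]
  refine Finset.sum_congr rfl fun y _ => ?_
  have he : ∀ b, ∏ j ∈ Finset.univ.erase i,
      (if (i.insertNth b y : Fin (m + 1) → Bool) j then p else 1 - p) = muW m p y := by
    intro b
    have : (Finset.univ.erase i) = Finset.univ.map i.succAboveEmb := by
      ext j
      simp [Fin.exists_succAbove_eq_iff]
    rw [this, Finset.prod_map]
    simp [muW]
  have hE : ∀ b : Bool, (∏ j ∈ Finset.univ.erase i,
      (if (Fin.insertNthEquiv (fun _ => Bool) i (b, y)) j then p else 1 - p)) = muW m p y :=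
    fun b => he b
  simp only [Fintype.sum_bool, hE]
  simp [grad, Fin.insertNthEquiv]
  ring

lemma grad_ind (A : Finset (Fin n → Bool)) (hA : MonotoneSet n A) (i : Fin n) (x : Fin n → Bool) :
    grad n i (indA A) x = 0 ∨ grad n i (indA A) x = 1 := by
  unfold grad indA
  by_cases h1 : Function.update x i false ∈ A
  · have h2 : Function.update x i true ∈ A := by
      refine hA _ h1 _ fun j => ?_
      by_cases hj : j = i
      · subst hj; simp
      · simp [hj]
    simp [h1, h2]
  · by_cases h2 : Function.update x i true ∈ A <;> simp [h1, h2]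

lemma muE_perm (g : Equiv.Perm (Fin n)) (F : (Fin n → Bool) → ℝ) :
    muE n p (fun x => F (fun i => x (g⁻¹ i))) = muE n p F := by
  unfold muE
  rw [← (Equiv.arrowCongr g (Equiv.refl Bool)).sum_comp (fun x => muW n p x * F x)]
  refine Finset.sum_congr rfl fun x _ => ?_
  have : muW n p ((Equiv.arrowCongr g (Equiv.refl Bool)) x) = muW n p x := by
    unfold muW
    rw [← Equiv.prod_comp g]
    simp [Equiv.arrowCongr]
  rw [this]
  rfl

lemma grad_symm (A : Finset (Fin n → Bool)) (hA : SymmetricSet n A) (i j : Fin n) :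
    muE n p (grad n i (indA A)) = muE n p (grad n j (indA A)) := by
  obtain ⟨G, htr, hG⟩ := hA
  obtain ⟨g, hg, rfl⟩ := htr i j
  rw [← muE_perm g (grad n (g i) (indA A))]
  congr 1
  funext x
  have hinv : ∀ y, indA A (fun i => y (g⁻¹ i)) = indA A y := by
    intro y
    unfold indA
    have : (fun i => y (g⁻¹ i)) ∈ A ↔ y ∈ A := by
      constructor
      · intro h
        have := hG g⁻¹ (G.inv_mem hg) _ h
        simpa using this
      · exact hG g hg y
    simp only [this]
  have hup : ∀ b, Function.update (fun k => x (g⁻¹ k)) (g i) b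
      = fun k => (Function.update x i b) (g⁻¹ k) := by
    intro b
    funext k
    by_cases hk : k = g i
    · subst hk; simp
    · have : g⁻¹ k ≠ i := fun h => hk (by rw [← h]; simp)
      rw [Function.update_of_ne hk, Function.update_of_ne this]
  unfold grad
  rw [hup, hup, hinv, hinv]

lemma deriv_bound (hn : 2 ≤ n) (hp : 0 < p) (hp1 : p < 1) (A : Finset (Fin n → Bool))
    (hA : MonotoneSet n A) (hS : SymmetricSet n A) (hne : A.Nonempty) (hnu : A ≠ Finset.univ) :
    0 < muP n p A ∧ muP n p A < 1 ∧ muP n p A * (1 - muP n p A) * Real.log n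
      ≤ 5 * (p * (1 - p) * Real.log (2 / (p * (1 - p)))) *
        ∑ i, muE n p (grad n i (indA A)) := by
  have hq : 0 < 1 - p := by linarith
  have hpq : 0 < p * (1 - p) := mul_pos hp hq
  have hpos : 0 < muP n p A := Finset.sum_pos (fun x _ => muW_pos hp hp1 x) hne
  have hlt : muP n p A < 1 := by
    have h1 : ∑ x : Fin n → Bool, muW n p x = 1 := by
      have := muE_one (n := n) (p := p); simpa [muE] using this
    rw [← h1]
    obtain ⟨z, hz⟩ : ∃ z, z ∉ A := by
      by_contra hcon
      push Not at hcon
      exact hnu (Finset.eq_univ_iff_forall.2 hcon)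
    exact Finset.sum_lt_sum_of_subset (Finset.subset_univ A) (Finset.mem_univ z) hz
      (muW_pos hp hp1 z) (fun x _ _ => (muW_pos hp hp1 x).le)
  refine ⟨hpos, hlt, ?_⟩
  set μ := muP n p A with hμ
  set J := muE n p (grad n ⟨0, by omega⟩ (indA A)) with hJ
  have hJi : ∀ i, muE n p (grad n i (indA A)) = J := fun i => grad_symm A hS _ _
  have hJ0 : 0 ≤ J := muE_nonneg hp hp1 fun x => by
    rcases grad_ind A hA ⟨0, by omega⟩ x with h | h <;> rw [h] <;> norm_num
  have hsum : ∑ i, muE n p (grad n i (indA A)) = n * J := by simp [hJi]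
  have hf2 : muE n p (fun x => indA A x ^ 2) = μ := by
    rw [hμ, muP_eq]
    congr 1
    funext x
    unfold indA
    split_ifs <;> norm_num
  have key := main_ineq (by omega) hp hp1 (indA A) J
    (fun i => by
      rw [← hJi i]; congr 1; funext x
      rcases grad_ind A hA i x with h | h <;> rw [h] <;> norm_num)
    (fun i => by
      rw [← hJi i]; congr 1; funext x
      rcases grad_ind A hA i x with h | h <;> rw [h] <;> norm_num)
    (μ * (1 - μ)) (by rw [hf2, ← muP_eq, ← hμ]; ring) (mul_pos hpos (by linarith))
    (by nlinarith [sq_nonneg (μ - 1 / 2)])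
  rw [hsum]
  refine key.trans ?_
  have hl2 : (0.69 : ℝ) < Real.log 2 := by have := Real.log_two_gt_d9; linarith
  have hl4 : 2 * Real.log 2 ≤ Real.log (1 / (p * (1 - p))) := by
    have e : 2 * Real.log 2 = Real.log 4 := by
      rw [show (4 : ℝ) = 2 ^ 2 by norm_num, Real.log_pow]; push_cast; ring
    rw [e]
    apply Real.log_le_log (by norm_num)
    rw [le_div_iff₀ hpq]
    nlinarith [sq_nonneg (p - 1 / 2)]
  have e2 : Real.log (2 / (p * (1 - p))) = Real.log 2 + Real.log (1 / (p * (1 - p))) := by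
    rw [← Real.log_mul (by norm_num) (by positivity)]; congr 1; ring
  have hY : 0 ≤ p * (1 - p) * (n * J) := by positivity
  calc (5 + 2 * Real.log (1 / (p * (1 - p)))) * (p * (1 - p) * (n * J))
      ≤ (5 * Real.log (2 / (p * (1 - p)))) * (p * (1 - p) * (n * J)) := by
        apply mul_le_mul_of_nonneg_right _ hY
        rw [e2]; linarith
    _ = _ := by ring

end Sets

/-- Corollary 1.5: There is a universal `C > 0` such that for every `n ≥ 2`,
every nontrivial monotone symmetric `A ⊆ {0,1}^n` and every `ε ∈ (0,1/2)`,
`τ(A,ε) ≤ C · sup_{p ∈ [p(ε),p(1-ε)]} {p(1-p) log(2/(p(1-p)))} · log((1-ε)/ε)/log n`. -/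
theorem stmt2 :
    ∃ C > (0 : ℝ), ∀ n : ℕ, 2 ≤ n → ∀ A : Finset (Fin n → Bool),
      MonotoneSet n A → SymmetricSet n A → A.Nonempty → A ≠ Finset.univ →
      ∀ ε ∈ Set.Ioo (0 : ℝ) (1 / 2), ∀ pe p1e : ℝ,
        pe ∈ Set.Ioo (0 : ℝ) 1 → muP n pe A = ε →
        p1e ∈ Set.Ioo (0 : ℝ) 1 → muP n p1e A = 1 - ε →
        p1e - pe ≤
          C * sSup ((fun p => p * (1 - p) * Real.log (2 / (p * (1 - p)))) ''
              Set.Icc pe p1e) *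
            (Real.log ((1 - ε) / ε) / Real.log n) := by
  refine ⟨10, by norm_num, ?_⟩
  intro n hn A hA hS hne hnu ε hε pe p1e hpe hμe hp1e hμ1e
  obtain ⟨hε0, hε1⟩ := hε
  set F : ℝ → ℝ := fun p => p * (1 - p) * Real.log (2 / (p * (1 - p))) with hF
  have hlogn : 0 < Real.log n := Real.log_pos (by exact_mod_cast (by omega : 1 < n))
  have hFpos : ∀ p ∈ Set.Ioo (0 : ℝ) 1, 0 < F p := by
    rintro p ⟨h0, h1⟩
    have hpq : 0 < p * (1 - p) := mul_pos h0 (by linarith)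
    refine mul_pos hpq (Real.log_pos ?_)
    rw [lt_div_iff₀ hpq]
    nlinarith
  have hsub : Set.Icc pe p1e ⊆ Set.Ioo (0 : ℝ) 1 := fun p hp =>
    ⟨lt_of_lt_of_le hpe.1 hp.1, lt_of_le_of_lt hp.2 hp1e.2⟩
  have hlogε : 0 < Real.log ((1 - ε) / ε) := by
    apply Real.log_pos
    rw [lt_div_iff₀ hε0]; linarith
  rcases le_or_gt p1e pe with hle | hlt
  · have hS0 : 0 ≤ sSup (F '' Set.Icc pe p1e) := by
      apply Real.sSup_nonneg
      rintro _ ⟨p, hp, rfl⟩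
      exact (hFpos p (hsub hp)).le
    have : 0 ≤ 10 * sSup (F '' Set.Icc pe p1e) * (Real.log ((1 - ε) / ε) / Real.log n) := by
      positivity
    linarith
  · have hcont : ContinuousOn F (Set.Icc pe p1e) := by
      intro p hp
      have hp' := hsub hp
      have hpq : 0 < p * (1 - p) := mul_pos hp'.1 (by linarith [hp'.2])
      have h1 : ContinuousAt (fun p : ℝ => p * (1 - p)) p := by fun_prop
      have h2 : ContinuousAt (fun p : ℝ => Real.log (2 / (p * (1 - p)))) p :=
        (continuousAt_const.div h1 hpq.ne').log (div_pos two_pos hpq).ne'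
      exact (h1.mul h2).continuousWithinAt
    have hbdd : BddAbove (F '' Set.Icc pe p1e) := (isCompact_Icc.image_of_continuousOn hcont).bddAbove
    set S := sSup (F '' Set.Icc pe p1e) with hSdef
    have hFS : ∀ p ∈ Set.Icc pe p1e, F p ≤ S := fun p hp => le_csSup hbdd ⟨p, hp, rfl⟩
    have hS0 : 0 < S := lt_of_lt_of_le (hFpos pe hpe) (hFS pe ⟨le_rfl, hlt.le⟩)
    set φ : ℝ → ℝ := fun p => Real.log (muP n p A) - Real.log (1 - muP n p A) with hφ
    have hder : ∀ p ∈ Set.Ioo (0 : ℝ) 1, HasDerivAt φ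
        ((∑ i, muE n p (grad n i (indA A))) / (muP n p A)
          - (-(∑ i, muE n p (grad n i (indA A)))) / (1 - muP n p A)) p := by
      intro p hp
      obtain ⟨h1, h2, -⟩ := deriv_bound hn hp.1 hp.2 A hA hS hne hnu
      have hd : HasDerivAt (fun p => muP n p A) (∑ i, muE n p (grad n i (indA A))) p := by
        simp only [muP_eq]
        exact muE_hasDeriv _
      exact (hd.log h1.ne').sub ((hd.const_sub 1).log (by linarith))
    have hmvt : Real.log n / (5 * S) * (p1e - pe) ≤ φ p1e - φ pe := by
      refine Convex.mul_sub_le_image_sub_of_le_deriv (convex_Icc pe p1e) (f := φ)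
        (fun p hp => (hder p (hsub hp)).continuousAt.continuousWithinAt) ?_ ?_ pe ⟨le_rfl, hlt.le⟩
        p1e ⟨hlt.le, le_rfl⟩ hlt.le
      · intro p hp
        exact (hder p (hsub (interior_subset hp))).differentiableAt.differentiableWithinAt
      · intro p hp
        have hp2 := interior_subset hp
        have hp' := hsub hp2
        rw [(hder p hp').deriv]
        obtain ⟨h1, h2, h3⟩ := deriv_bound hn hp'.1 hp'.2 A hA hS hne hnu
        have h4 := hFS p hp2
        set μ := muP n p A
        set I := ∑ i, muE n p (grad n i (indA A))
        have h2' : 0 < 1 - μ := by linarith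
        have hFp := hFpos p hp'
        have hI : 0 ≤ I := by
          by_contra hcon
          have a1 : 0 < μ * (1 - μ) * Real.log n := by positivity
          have a2 : 5 * F p * I ≤ 0 :=
            mul_nonpos_of_nonneg_of_nonpos (by positivity) (by linarith)
          have a3 : μ * (1 - μ) * Real.log n ≤ 5 * F p * I := h3
          linarith
        have h5 : μ * (1 - μ) * Real.log n ≤ 5 * S * I := by
          refine le_trans h3 ?_
          apply mul_le_mul_of_nonneg_right _ hI
          have : F p ≤ S := h4
          simp only [hF] at this
          linarith
        have e : I / μ - -I / (1 - μ) = I / (μ * (1 - μ)) := by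
          field_simp
          ring
        rw [e, div_le_div_iff₀ (by positivity) (by positivity)]
        linarith
    have hφd : φ p1e - φ pe = 2 * Real.log ((1 - ε) / ε) := by
      simp only [hφ, hμe, hμ1e]
      rw [Real.log_div (by linarith) hε0.ne', sub_sub_cancel]
      ring
    rw [hφd] at hmvt
    have : p1e - pe = (Real.log n / (5 * S) * (p1e - pe)) * (5 * S / Real.log n) := by
      field_simp
    rw [this]
    refine (mul_le_mul_of_nonneg_right hmvt (by positivity)).trans (le_of_eq ?_)
    ring
end

section
/- For every positive integer n, every real function f on {0,1}^n, and every p ∈ [0,1], the derivative with respect to p of the polynomial map p ↦ ∫ f dμ_{n,p} equals ∑_{i=1}^n ∫ ∇_i f dμ_{n,p}. -/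
open Finset

/-- Averaging over the `i`-th fiber. -/
theorem two_mul_sum_fiber (n : ℕ) (i : Fin n) (h : (Fin n → Bool) → ℝ) :
    2 * ∑ x, h x =
      ∑ x, (h (Function.update x i true) + h (Function.update x i false)) := by
  have hinv : Function.Involutive
      (fun x : Fin n → Bool => Function.update x i (!(x i))) := by
    intro x
    simp
  have h1 : ∑ x, h (Function.update x i (!(x i))) = ∑ x, h x :=
    Equiv.sum_comp hinv.toPerm h
  rw [two_mul]
  nth_rewrite 2 [← h1]
  rw [← Finset.sum_add_distrib]
  refine Finset.sum_congr rfl fun x _ => ?_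
  have hx : Function.update x i (x i) = x := Function.update_eq_self i x
  cases hxi : x i
  · rw [hxi] at hx
    rw [hx, Bool.not_false, add_comm]
  · rw [hxi] at hx
    rw [hx, Bool.not_true]

/-- The weight of the coordinates other than `i`. -/
noncomputable def restW (n : ℕ) (p : ℝ) (i : Fin n) (x : Fin n → Bool) : ℝ :=
  ∏ j ∈ Finset.univ.erase i, if x j then p else 1 - p

theorem restW_update (n : ℕ) (p : ℝ) (i : Fin n) (x : Fin n → Bool) (b : Bool) :
    restW n p i (Function.update x i b) = restW n p i x := by
  unfold restW
  refine Finset.prod_congr rfl fun j hj => ?_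
  rw [Function.update_of_ne (Finset.ne_of_mem_erase hj)]

theorem muW_eq_restW (n : ℕ) (p : ℝ) (i : Fin n) (x : Fin n → Bool) :
    muW n p x = (if x i then p else 1 - p) * restW n p i x :=
  (Finset.mul_prod_erase Finset.univ _ (Finset.mem_univ i)).symm

theorem hasDerivAt_muW (n : ℕ) (p : ℝ) (x : Fin n → Bool) :
    HasDerivAt (fun q => muW n q x)
      (∑ i, restW n p i x * (if x i then 1 else -1)) p := by
  have := HasDerivAt.fun_finsetProd (u := Finset.univ)
    (f := fun (i : Fin n) (q : ℝ) => if x i then q else 1 - q)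
    (f' := fun i => if x i then (1 : ℝ) else -1) (x := p) (fun i _ => by
      cases x i
      · simpa using (hasDerivAt_id p).const_sub 1
      · simpa using hasDerivAt_id' p)
  simpa [muW, restW] using this

theorem sum_fiber_eq (n : ℕ) (p : ℝ) (i : Fin n) (f : (Fin n → Bool) → ℝ) :
    ∑ x, restW n p i x * (if x i then 1 else -1) * f x = muE n p (grad n i f) := by
  have h1 := two_mul_sum_fiber n i
    (fun x => restW n p i x * (if x i then 1 else -1) * f x)
  have h2 := two_mul_sum_fiber n i (fun x => muW n p x * grad n i f x)
  have h3 : 2 * ∑ x, restW n p i x * (if x i then 1 else -1) * f x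
      = 2 * ∑ x, muW n p x * grad n i f x := by
    rw [h1, h2]
    refine Finset.sum_congr rfl fun x _ => ?_
    simp only [muW_eq_restW n p i, restW_update, grad, Function.update_self,
      Function.update_idem, if_true, Bool.false_eq_true, if_false]
    ring
  unfold muE
  linarith

/-- Lemma 2.2: `d/dp ∫ f dμ_p = ∑ᵢ ∫ ∇ᵢ f dμ_p`. -/
theorem stmt5 (n : ℕ) (hn : 0 < n) (f : (Fin n → Bool) → ℝ)
    (p : ℝ) (hp : p ∈ Set.Icc (0 : ℝ) 1) :
    deriv (fun q => muE n q f) p = ∑ i : Fin n, muE n p (grad n i f) := by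
  have h : HasDerivAt (fun q => muE n q f)
      (∑ x, (∑ i, restW n p i x * (if x i then 1 else -1)) * f x) p := by
    unfold muE
    exact HasDerivAt.fun_sum fun x _ => (hasDerivAt_muW n p x).mul_const (f x)
  rw [h.deriv]
  simp only [Finset.sum_mul]
  rw [Finset.sum_comm]
  exact Finset.sum_congr rfl fun i _ => sum_fiber_eq n p i f
end

section
/- Let n be a positive integer, p ∈ (0,1), and let f be a real function on {0,1}^n such that ∇_i f(x) ∈ {0,1} for all i ∈ {1,…,n} and all x. Then the derivative with respect to p of the polynomial map p ↦ ∫ f dμ_{n,p} equals (1/(p(1−p))) · ∑_{i=1}^n ∫ (Δ_i f)^2 dμ_{n,p}. -/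
open Finset

lemma sum_pair_eq (n : ℕ) (i : Fin n) (F G : (Fin n → Bool) → ℝ)
    (h : ∀ x, F (Function.update x i true) + F (Function.update x i false) =
      G (Function.update x i true) + G (Function.update x i false)) :
    ∑ x, F x = ∑ x, G x := by
  have key : ∀ H : (Fin n → Bool) → ℝ, 2 * ∑ x, H x =
      ∑ x, (H (Function.update x i true) + H (Function.update x i false)) := by
    intro H
    have hinv : Function.Involutive
        (fun x : Fin n → Bool => Function.update x i (!(x i))) := by
      intro x
      simp
    have h1 : ∑ x, H (Function.update x i (!(x i))) = ∑ x, H x :=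
      Equiv.sum_comp hinv.toPerm H
    rw [two_mul]
    nth_rewrite 2 [← h1]
    rw [← Finset.sum_add_distrib]
    refine Finset.sum_congr rfl fun x _ => ?_
    have hx := Function.update_eq_self i x
    cases hb : x i
    · rw [hb] at hx
      rw [hx, add_comm]; rfl
    · rw [hb] at hx
      rw [hx]; rfl
  have := key F
  rw [Finset.sum_congr rfl (fun x _ => h x), ← key G] at this
  linarith

lemma hasDerivAt_muE (n : ℕ) (p : ℝ) (f : (Fin n → Bool) → ℝ) :
    HasDerivAt (fun q => muE n q f)
      (∑ x : Fin n → Bool, (∑ i : Fin n,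
        (∏ j ∈ univ.erase i, if x j then p else 1 - p) *
          (if x i then (1 : ℝ) else -1)) * f x) p := by
  unfold muE muW
  refine HasDerivAt.fun_sum fun x _ => ?_
  refine HasDerivAt.mul_const ?_ _
  have := HasDerivAt.fun_finsetProd (u := (univ : Finset (Fin n)))
    (f := fun i q => if x i then q else 1 - q)
    (f' := fun i => if x i then (1 : ℝ) else -1) (x := p) (fun i _ => by
      cases x i
      · simpa using (hasDerivAt_id p).const_sub 1
      · simpa using hasDerivAt_id' p)
  simpa only [smul_eq_mul] using this

/-- Lemma 3.1: if `∇ᵢ f ∈ {0,1}` for all `i`, then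
`d/dp ∫ f dμ_p = (1/(p(1-p))) ∑ᵢ ∫ (Δᵢ f)² dμ_p`. -/
theorem stmt9 (n : ℕ) (hn : 0 < n) (p : ℝ) (hp : p ∈ Set.Ioo (0 : ℝ) 1)
    (f : (Fin n → Bool) → ℝ)
    (hgrad : ∀ (i : Fin n) (x : Fin n → Bool), grad n i f x = 0 ∨ grad n i f x = 1) :
    deriv (fun q => muE n q f) p =
      1 / (p * (1 - p)) * ∑ i : Fin n, muE n p (fun x => del n p i f x ^ 2) := by
  obtain ⟨hp0, hp1⟩ := hp
  have hp2 : 1 - p ≠ 0 := by linarith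
  have hp3 : p ≠ 0 := hp0.ne'
  rw [(hasDerivAt_muE n p f).deriv]
  simp_rw [Finset.sum_mul]
  rw [Finset.sum_comm, Finset.mul_sum]
  refine Finset.sum_congr rfl fun i _ => ?_
  unfold muE
  rw [Finset.mul_sum]
  refine sum_pair_eq n i _ _ fun x => ?_
  have hP : ∀ b : Bool, (∏ j ∈ univ.erase i, if Function.update x i b j then p else 1 - p) =
      ∏ j ∈ univ.erase i, if x j then p else 1 - p := by
    intro b
    refine Finset.prod_congr rfl fun j hj => ?_
    rw [Function.update_of_ne (Finset.ne_of_mem_erase hj)]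
  have hW : ∀ b : Bool, muW n p (Function.update x i b) =
      (if b then p else 1 - p) * ∏ j ∈ univ.erase i, if x j then p else 1 - p := by
    intro b
    rw [← hP b, muW, ← Finset.mul_prod_erase univ _ (Finset.mem_univ i), Function.update_self]
  rw [hW, hW, hP, hP]
  have hg := hgrad i x
  unfold grad at hg
  simp only [del, Function.update_self, Function.update_idem]
  generalize (∏ j ∈ univ.erase i, if x j then p else 1 - p) = P
  have hg2 : (f (Function.update x i true) - f (Function.update x i false)) ^ 2 =
      f (Function.update x i true) - f (Function.update x i false) := by
    rcases hg with h | h <;> rw [h] <;> norm_num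
  generalize f (Function.update x i true) = a at *
  generalize f (Function.update x i false) = b at *
  simp only [if_true, Bool.false_eq_true, if_false]
  field_simp
  linear_combination (-P * p * (1 - p)) * hg2
end
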